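/- Let K ⊂ ℝ^{n+1} be a smooth, strictly convex body with the origin in its interior, with support function h, Gauss curvature 𝒦 and cone-volume measure dV = h σ_n dμ (σ_n = 1/𝒦). If ∫ f h σ_n dμ = 0 for a smooth f : S^n → ℝ, then n ∫ f² h σ_n dμ ≤ ∫ h² σ_n^{ij} ∂_i f ∂_j f dμ, where σ_n^{ij} is the cofactor matrix of A[h] = ∇̄²h + hḡ. Equality holds iff f(x) = ⟨x/h(x), v⟩ for some v ∈ ℝ^{n+1}. -/

import Mathlib

open MeasureTheory Metric
open scoped RealInnerProductSpace ENNReal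

noncomputable section

abbrev E (n : ℕ) : Type := EuclideanSpace ℝ (Fin (n + 1))

/-- The Hessian of `H` as a continuous linear map. -/
def hess {n : ℕ} (H : E n → ℝ) (x : E n) : E n →L[ℝ] E n :=
  fderiv ℝ (gradient H) x

/-- The rank-one projection `y ↦ ⟪x, y⟫ • x`. -/
def proj {n : ℕ} (x : E n) : E n →L[ℝ] E n :=
  ((innerSL ℝ) x).smulRight x

/-- `σ_n = det(∇̄²h + h ḡ)/det ḡ = 1/𝒦`, computed as the determinant of
`D²H + x ⊗ x` where `H` is the 1-homogeneous extension of the support function. -/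
def sigmaDet {n : ℕ} (H : E n → ℝ) (x : E n) : ℝ :=
  LinearMap.det ((hess H x + proj x) : E n →L[ℝ] E n).toLinearMap

/-- Tangential (spherical) gradient of the restriction to the unit sphere. -/
def tgrad {n : ℕ} (F : E n → ℝ) (x : E n) : E n :=
  gradient F x - ⟪gradient F x, x⟫ • x

/-- The convex body with support function `H`. -/
def body {n : ℕ} (H : E n → ℝ) : Set (E n) :=
  {y | ∀ x ∈ sphere (0 : E n) 1, ⟪y, x⟫ ≤ H x}

section Auxiliary

set_option linter.unusedSectionVars false

open Set

theorem volume_add_volume_le_of_isCompact {K L : Set ℝ} (hK : IsCompact K) (hL : IsCompact L)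
    (hK0 : K.Nonempty) (hL0 : L.Nonempty) {C : Set ℝ}
    (hC : ∀ x ∈ K, ∀ y ∈ L, x + y ∈ C) : volume K + volume L ≤ volume C := by
  obtain ⟨a, haK, ha⟩ := hK.exists_isGreatest hK0
  obtain ⟨b, hbL, hb⟩ := hL.exists_isLeast hL0
  have h1 : volume ((fun x => x + b) '' K) = volume K := by
    simp
  have h2 : volume ((fun x => a + x) '' L) = volume L := by
    simp
  have hdisj : AEDisjoint volume ((fun x => x + b) '' K) ((fun x => a + x) '' L) := by
    refine measure_mono_null (t := {a + b}) ?_ (by simp)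
    rintro _ ⟨⟨x, hx, rfl⟩, ⟨y, hy, hxy⟩⟩
    have e1 := ha hx
    have e2 := hb hy
    simp only at hxy
    simp only [mem_singleton_iff]
    linarith
  have hm : NullMeasurableSet ((fun x => a + x) '' L) :=
    (hL.image (by fun_prop)).measurableSet.nullMeasurableSet
  rw [← h1, ← h2, ← measure_union₀ hm hdisj]
  refine measure_mono ?_
  rintro _ (⟨x, hx, rfl⟩ | ⟨y, hy, rfl⟩)
  · exact hC x hx b hbL
  · exact hC a haK y hy

theorem volume_add_volume_le {A B C : Set ℝ} (hA : MeasurableSet A) (hB : MeasurableSet B)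
    (hA0 : A.Nonempty) (hB0 : B.Nonempty)
    (hC : ∀ x ∈ A, ∀ y ∈ B, x + y ∈ C) : volume A + volume B ≤ volume C := by
  obtain ⟨a, ha⟩ := hA0
  obtain ⟨b, hb⟩ := hB0
  have sup : ∀ S : Set ℝ, MeasurableSet S →
      volume S = ⨆ K : {K : Set ℝ // K ⊆ S ∧ IsCompact K}, volume K.1 := by
    intro S hS
    rw [hS.measure_eq_iSup_isCompact, iSup_subtype]
    simp only [iSup_and]
  have ne : ∀ S : Set ℝ, Nonempty {K : Set ℝ // K ⊆ S ∧ IsCompact K} := fun S =>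
    ⟨⟨∅, empty_subset _, isCompact_empty⟩⟩
  have := ne A
  have := ne B
  rw [sup A hA, sup B hB]
  refine ENNReal.iSup_add_iSup_le fun ⟨K, hK, hKc⟩ ⟨L, hL, hLc⟩ => ?_
  calc volume K + volume L ≤ volume (insert a K) + volume (insert b L) := by
        gcongr <;> exact subset_insert _ _
    _ ≤ volume C := by
        refine volume_add_volume_le_of_isCompact (hKc.insert a) (hLc.insert b)
          (insert_nonempty _ _) (insert_nonempty _ _) ?_
        intro x hx y hy
        exact hC x (insert_subset ha hK hx) y (insert_subset hb hL hy)

theorem lintegral_add_lintegral_le_of_mul_le_sq {f g h : ℝ → ℝ} (hf : Measurable f)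
    (hg : Measurable g) (hh : Measurable h) (hf0 : ∀ x, 0 ≤ f x) (hg0 : ∀ x, 0 ≤ g x)
    (hh0 : ∀ x, 0 ≤ h x) (hf1 : ∀ x, f x ≤ 1) (hg1 : ∀ x, g x ≤ 1)
    (hfs : ∀ t < 1, ∃ x, t < f x) (hgs : ∀ t < 1, ∃ x, t < g x)
    (H : ∀ x y, f x * g y ≤ h (x + y) ^ 2) :
    (∫⁻ x, ENNReal.ofReal (f x)) + ∫⁻ x, ENNReal.ofReal (g x) ≤ ∫⁻ x, ENNReal.ofReal (h x) := by
  rw [lintegral_eq_lintegral_meas_lt _ (.of_forall hf0) hf.aemeasurable,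
    lintegral_eq_lintegral_meas_lt _ (.of_forall hg0) hg.aemeasurable,
    lintegral_eq_lintegral_meas_lt _ (.of_forall hh0) hh.aemeasurable, ← lintegral_add_left]
  · refine setLIntegral_mono' measurableSet_Ioi fun t (ht : 0 < t) => ?_
    by_cases ht1 : t < 1
    · refine volume_add_volume_le (measurableSet_lt measurable_const hf)
        (measurableSet_lt measurable_const hg) (hfs t ht1) (hgs t ht1) ?_
      intro x (hx : t < f x) y (hy : t < g y)
      have := H x y
      have h3 : t * t < f x * g y := by nlinarith
      show t < h (x + y)
      by_contra hcon
      push Not at hcon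
      nlinarith [hh0 (x + y)]
    · have e1 : {a | t < f a} = ∅ := by
        ext x; simp only [mem_ofPred_eq, mem_empty_iff_false, iff_false]; linarith [hf1 x]
      have e2 : {a | t < g a} = ∅ := by
        ext x; simp only [mem_ofPred_eq, mem_empty_iff_false, iff_false]; linarith [hg1 x]
      simp [e1, e2]
  · exact Antitone.measurable fun s t hst => measure_mono fun x hx => lt_of_le_of_lt hst hx

theorem ENNReal.four_mul_le_sq_add' (x y : ℝ≥0∞) : 4 * (x * y) ≤ (x + y) ^ 2 := by
  by_cases hx : x = ⊤
  · simp [hx]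
  by_cases hy : y = ⊤
  · simp [hy]
  lift x to NNReal using hx
  lift y to NNReal using hy
  norm_cast
  rw [← NNReal.coe_le_coe]
  push_cast
  nlinarith [sq_nonneg ((x : ℝ) - y)]

theorem four_mul_lintegral_le_of_bounded {f g h : ℝ → ℝ} (hf : Measurable f)
    (hg : Measurable g) (hh : Measurable h) (hf0 : ∀ x, 0 ≤ f x) (hg0 : ∀ x, 0 ≤ g x)
    (hh0 : ∀ x, 0 ≤ h x) (hfb : BddAbove (range f)) (hgb : BddAbove (range g))
    (H : ∀ x y, f x * g y ≤ h (x + y) ^ 2) :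
    4 * ((∫⁻ x, ENNReal.ofReal (f x)) * ∫⁻ x, ENNReal.ofReal (g x)) ≤
      (∫⁻ x, ENNReal.ofReal (h x)) ^ 2 := by
  have sup_pos : ∀ u : ℝ → ℝ, (∀ x, 0 ≤ u x) → BddAbove (range u) →
      ¬ (∫⁻ x, ENNReal.ofReal (u x)) = 0 → 0 < ⨆ x, u x := by
    intro u hu hub hint
    by_contra hcon
    push Not at hcon
    apply hint
    have : ∀ x, u x = 0 := fun x => le_antisymm ((le_ciSup hub x).trans hcon) (hu x)
    simp [this]
  by_cases hf_zero : (∫⁻ x, ENNReal.ofReal (f x)) = 0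
  · simp [hf_zero]
  by_cases hg_zero : (∫⁻ x, ENNReal.ofReal (g x)) = 0
  · simp [hg_zero]
  set a := ⨆ x, f x with ha
  set b := ⨆ x, g x with hb
  have ha0 : 0 < a := sup_pos f hf0 hfb hf_zero
  have hb0 : 0 < b := sup_pos g hg0 hgb hg_zero
  have hs : 0 < √(a * b) := Real.sqrt_pos.2 (mul_pos ha0 hb0)
  have hss : √(a * b) ^ 2 = a * b := Real.sq_sqrt (mul_pos ha0 hb0).le
  have key := lintegral_add_lintegral_le_of_mul_le_sq (f := fun x => a⁻¹ * f x)
    (g := fun x => b⁻¹ * g x) (h := fun x => (√(a * b))⁻¹ * h x) (by fun_prop) (by fun_prop)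
    (by fun_prop) (fun x => mul_nonneg (by positivity) (hf0 x))
    (fun x => mul_nonneg (by positivity) (hg0 x)) (fun x => mul_nonneg (by positivity) (hh0 x))
    (fun x => by rw [inv_mul_le_one₀ ha0]; exact le_ciSup hfb x)
    (fun x => by rw [inv_mul_le_one₀ hb0]; exact le_ciSup hgb x)
    (fun t ht => by
      obtain ⟨x, hx⟩ := exists_lt_of_lt_ciSup (f := f) (b := a * t) (by rw [← ha]; nlinarith)
      exact ⟨x, by rwa [lt_inv_mul_iff₀ ha0]⟩)
    (fun t ht => by
      obtain ⟨x, hx⟩ := exists_lt_of_lt_ciSup (f := g) (b := b * t) (by rw [← hb]; nlinarith)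
      exact ⟨x, by rwa [lt_inv_mul_iff₀ hb0]⟩)
    (fun x y => by
      rw [mul_pow, inv_pow, hss]
      calc a⁻¹ * f x * (b⁻¹ * g y) = (a * b)⁻¹ * (f x * g y) := by field_simp
        _ ≤ _ := by gcongr; exact H x y)
  have pull : ∀ (c : ℝ) (u : ℝ → ℝ), 0 ≤ c → Measurable u →
      ∫⁻ x, ENNReal.ofReal (c * u x) = ENNReal.ofReal c * ∫⁻ x, ENNReal.ofReal (u x) := by
    intro c u hc hu
    simp_rw [ENNReal.ofReal_mul hc]
    rw [lintegral_const_mul _ (by fun_prop)]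
  rw [pull _ _ (by positivity) hf, pull _ _ (by positivity) hg, pull _ _ (by positivity) hh] at key
  have key2 := (ENNReal.four_mul_le_sq_add' _ _).trans (pow_le_pow_left' key 2)
  rw [mul_pow, ← ENNReal.ofReal_pow (by positivity), inv_pow, hss] at key2
  have e : ENNReal.ofReal (a * b) * ENNReal.ofReal (a * b)⁻¹ = 1 := by
    rw [← ENNReal.ofReal_mul (by positivity), mul_inv_cancel₀ (by positivity), ENNReal.ofReal_one]
  have e_inv : ENNReal.ofReal a⁻¹ * ENNReal.ofReal b⁻¹ = ENNReal.ofReal (a * b)⁻¹ := by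
    rw [← ENNReal.ofReal_mul (by positivity), mul_inv]
  have key3 := mul_le_mul_right key2 (ENNReal.ofReal (a * b))
  rw [← mul_assoc (ENNReal.ofReal (a * b)) (ENNReal.ofReal (a * b)⁻¹), e, one_mul] at key3
  refine le_trans (le_of_eq ?_) key3
  calc 4 * ((∫⁻ x, ENNReal.ofReal (f x)) * ∫⁻ x, ENNReal.ofReal (g x))
      = (ENNReal.ofReal (a * b) * (ENNReal.ofReal a⁻¹ * ENNReal.ofReal b⁻¹)) *
        (4 * ((∫⁻ x, ENNReal.ofReal (f x)) * ∫⁻ x, ENNReal.ofReal (g x))) := by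
          rw [e_inv, e, one_mul]
    _ = _ := by ring

/-- One-dimensional Prékopa–Leindler inequality (midpoint case). -/
theorem four_mul_lintegral_mul_le_sq {f g h : ℝ → ℝ≥0∞} (hf : Measurable f)
    (hg : Measurable g) (hh : Measurable h) (H : ∀ x y, f x * g y ≤ h (x + y) ^ 2) :
    4 * ((∫⁻ x, f x) * ∫⁻ x, g x) ≤ (∫⁻ x, h x) ^ 2 := by
  have trunc : ∀ N : ℕ, 4 * ((∫⁻ x, min (f x) N) * ∫⁻ x, min (g x) N) ≤ (∫⁻ x, h x) ^ 2 := by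
    intro N
    have fin : ∀ u : ℝ → ℝ≥0∞, ∀ x, min (u x) (N : ℝ≥0∞) ≠ ⊤ := fun u x =>
      ne_top_of_le_ne_top (ENNReal.natCast_ne_top N) (min_le_right _ _)
    have bdd : ∀ u : ℝ → ℝ≥0∞, BddAbove (range fun x => (min (u x) (N : ℝ≥0∞)).toReal) := by
      intro u
      refine ⟨N, ?_⟩
      rintro _ ⟨x, rfl⟩
      have := ENNReal.toReal_mono (ENNReal.natCast_ne_top N) (min_le_right (u x) (N : ℝ≥0∞))
      simpa using this
    have key := four_mul_lintegral_le_of_bounded (f := fun x => (min (f x) (N : ℝ≥0∞)).toReal)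
      (g := fun x => (min (g x) (N : ℝ≥0∞)).toReal) (h := fun x => (min (h x) (N : ℝ≥0∞)).toReal)
      (by fun_prop) (by fun_prop) (by fun_prop) (fun _ => ENNReal.toReal_nonneg)
      (fun _ => ENNReal.toReal_nonneg) (fun _ => ENNReal.toReal_nonneg) (bdd f) (bdd g) ?_
    · simp only [ENNReal.ofReal_toReal (fin _ _)] at key
      refine key.trans ?_
      gcongr
      exact min_le_left _ _
    · intro x y
      rw [← ENNReal.toReal_mul, ← ENNReal.toReal_pow]
      refine ENNReal.toReal_mono (by simp [fin h]) ?_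
      rcases le_total (h (x + y)) (N : ℝ≥0∞) with hle | hle
      · rw [min_eq_left hle]
        refine le_trans ?_ (H x y)
        gcongr <;> exact min_le_left _ _
      · rw [min_eq_right hle, sq]
        gcongr <;> exact min_le_right _ _
  have lim : ∀ u : ℝ → ℝ≥0∞, Measurable u →
      Filter.Tendsto (fun N : ℕ => ∫⁻ x, min (u x) (N : ℝ≥0∞)) Filter.atTop
        (nhds (∫⁻ x, u x)) := by
    intro u hu
    refine lintegral_tendsto_of_tendsto_of_monotone (fun N => by fun_prop) ?_ ?_
    · refine .of_forall fun x M N hMN => ?_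
      simp only
      gcongr
    · refine .of_forall fun x => ?_
      have : Filter.Tendsto (fun N : ℕ => min (u x) (N : ℝ≥0∞)) Filter.atTop
          (nhds (min (u x) ⊤)) := tendsto_const_nhds.min ENNReal.tendsto_nat_nhds_top
      simpa using this
  by_cases hf_zero : (∫⁻ x, f x) = 0
  · simp [hf_zero]
  by_cases hg_zero : (∫⁻ x, g x) = 0
  · simp [hg_zero]
  refine le_of_tendsto' (ENNReal.Tendsto.const_mul (ENNReal.Tendsto.mul (lim f hf) (.inl hf_zero)
    (lim g hg) (.inl hg_zero)) (.inr (by simp))) trunc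

theorem four_pow_mul_lintegral_mul_le_sq (d : ℕ) {f g h : (Fin d → ℝ) → ℝ≥0∞} (hf : Measurable f)
    (hg : Measurable g) (hh : Measurable h) (H : ∀ x y, f x * g y ≤ h (x + y) ^ 2) :
    4 ^ d * ((∫⁻ x, f x) * ∫⁻ x, g x) ≤ (∫⁻ x, h x) ^ 2 := by
  induction d with
  | zero =>
    have e : ∀ u : (Fin 0 → ℝ) → ℝ≥0∞, ∫⁻ x, u x = u 0 := by
      intro u
      have : (fun x => u x) = fun _ => u 0 := by
        ext x; rw [Subsingleton.elim x 0]
      rw [this, lintegral_const]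
      simp [volume_pi]
    simp only [e, pow_zero, one_mul]
    simpa using H 0 0
  | succ d ih =>
    have e : ∀ u : (Fin (d + 1) → ℝ) → ℝ≥0∞, Measurable u →
        ∫⁻ x, u x = ∫⁻ s : ℝ, ∫⁻ z : Fin d → ℝ, u (Fin.cons s z) := by
      intro u hu
      have mp := (volume_preserving_piFinSuccAbove (fun _ : Fin (d + 1) => ℝ) 0).symm
      rw [← mp.lintegral_comp hu, Measure.volume_eq_prod, lintegral_prod]
      · simp [MeasurableEquiv.piFinSuccAbove, Fin.insertNthEquiv]
      · exact (hu.comp mp.measurable).aemeasurable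
    have mcons : Measurable fun p : ℝ × (Fin d → ℝ) => (Fin.cons p.1 p.2 : Fin (d + 1) → ℝ) := by
      refine measurable_pi_lambda _ fun i => ?_
      refine Fin.cases ?_ (fun j => ?_) i
      · simpa using measurable_fst
      · simp only [Fin.cons_succ]
        fun_prop
    have ms : ∀ (u : (Fin (d + 1) → ℝ) → ℝ≥0∞), Measurable u → ∀ s : ℝ,
        Measurable fun z : Fin d → ℝ => u (Fin.cons s z) := fun u hu s =>
      hu.comp (mcons.comp measurable_prodMk_left)
    have mi : ∀ (u : (Fin (d + 1) → ℝ) → ℝ≥0∞), Measurable u →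
        Measurable fun s : ℝ => ∫⁻ z : Fin d → ℝ, u (Fin.cons s z) := fun u hu =>
      Measurable.lintegral_prod_right' (f := fun p : ℝ × (Fin d → ℝ) => u (Fin.cons p.1 p.2))
        (hu.comp mcons)
    rw [e f hf, e g hg, e h hh]
    have key := four_mul_lintegral_mul_le_sq
      (f := fun s => 4 ^ d * ∫⁻ z : Fin d → ℝ, f (Fin.cons s z))
      (g := fun s => ∫⁻ z : Fin d → ℝ, g (Fin.cons s z))
      (h := fun s => ∫⁻ z : Fin d → ℝ, h (Fin.cons s z))
      ((mi f hf).const_mul _) (mi g hg) (mi h hh) ?_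
    · rw [lintegral_const_mul _ (mi f hf)] at key
      refine le_trans (le_of_eq ?_) key
      ring
    · intro s t
      rw [mul_assoc]
      refine ih (ms f hf s) (ms g hg t) (ms h hh (s + t)) fun x y => ?_
      refine (H _ _).trans (le_of_eq ?_)
      congr 2
      ext i
      refine Fin.cases ?_ (fun j => ?_) i <;> simp

open scoped Pointwise in
/-- Multiplicative Brunn–Minkowski inequality for midpoints. -/
theorem volume_mul_volume_le_sq {n : ℕ} {A B C : Set (E n)} (hA : MeasurableSet A)
    (hB : MeasurableSet B) (hC : MeasurableSet C)
    (H : ∀ x ∈ A, ∀ y ∈ B, (2⁻¹ : ℝ) • (x + y) ∈ C) :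
    volume A * volume B ≤ volume C ^ 2 := by
  have mp := PiLp.volume_preserving_toLp (Fin (n + 1))
  have mC : MeasurableSet ((2 : ℝ) • C) := hC.const_smul₀ 2
  have e : ∀ S : Set (E n), MeasurableSet S →
      volume S = ∫⁻ x : Fin (n + 1) → ℝ, (S.indicator 1 (WithLp.toLp 2 x) : ℝ≥0∞) := by
    intro S hS
    rw [mp.lintegral_comp (f := S.indicator 1) (measurable_one.indicator hS),
      lintegral_indicator_one hS]
  have mm : ∀ S : Set (E n), MeasurableSet S → Measurable
      fun x : Fin (n + 1) → ℝ => (S.indicator 1 (WithLp.toLp 2 x) : ℝ≥0∞) := fun S hS =>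
    (measurable_one.indicator hS).comp mp.measurable
  have key := four_pow_mul_lintegral_mul_le_sq (n + 1) (mm A hA) (mm B hB) (mm _ mC) ?_
  · rw [← e A hA, ← e B hB, ← e _ mC, Measure.addHaar_smul, mul_pow] at key
    have e2 : ENNReal.ofReal |(2 : ℝ) ^ Module.finrank ℝ (E n)| ^ 2 = 4 ^ (n + 1) := by
      rw [finrank_euclideanSpace_fin, abs_of_pos (by positivity),
        ← ENNReal.ofReal_pow (by positivity),
        ← pow_mul, mul_comm, pow_mul, ENNReal.ofReal_pow (by positivity)]
      norm_num
    rw [e2] at key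
    exact (ENNReal.mul_le_mul_iff_right (by positivity) (by finiteness)).1 key
  · intro x y
    by_cases hx : WithLp.toLp 2 x ∈ A
    · by_cases hy : WithLp.toLp 2 y ∈ B
      · have hz : WithLp.toLp 2 (x + y) ∈ (2 : ℝ) • C := by
          rw [mem_smul_set_iff_inv_smul_mem₀ two_ne_zero]
          exact H _ hx _ hy
        simp only [indicator_of_mem hx, indicator_of_mem hy, indicator_of_mem hz]
        simp
      · simp [hy]
    · simp [hx]

theorem exists_linearIsometryEquiv_apply_eq {n : ℕ} {x y : E n} (h : ‖x‖ = ‖y‖) :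
    ∃ e : E n ≃ₗᵢ[ℝ] E n, e x = y :=
  ⟨(ℝ ∙ (x - y))ᗮ.reflection, Submodule.reflection_sub h⟩

theorem measureReal_ball_eq {n : ℕ} {μ : Measure (E n)}
    (hinv : ∀ e : E n ≃ₗᵢ[ℝ] E n, μ.map e = μ) {x y : E n} (h : ‖x‖ = ‖y‖) (r : ℝ) :
    μ.real (ball x r) = μ.real (ball y r) := by
  obtain ⟨e, he⟩ := exists_linearIsometryEquiv_apply_eq h
  rw [measureReal_def, measureReal_def]
  congr 1
  nth_rewrite 2 [← hinv e]
  rw [Measure.map_apply e.continuous.measurable measurableSet_ball]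
  congr 1
  ext z
  simp only [mem_ball, mem_preimage, ← he, e.dist_map]

theorem measureReal_ball_pos {n : ℕ} {ν : Measure (E n)} [IsFiniteMeasure ν]
    (hν : ν (sphere 0 1)ᶜ = 0) (hνi : ∀ e : E n ≃ₗᵢ[ℝ] E n, ν.map e = ν) (hν0 : ν ≠ 0)
    {x : E n} (hx : x ∈ sphere (0 : E n) 1) {r : ℝ} (hr : 0 < r) : 0 < ν.real (ball x r) := by
  by_contra hcon
  have h0 : ν.real (ball x r) = 0 := le_antisymm (not_lt.1 hcon) measureReal_nonneg
  obtain ⟨t, ht, hcov⟩ := (isCompact_sphere (0 : E n) 1).elim_nhds_subcover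
    (fun x => ball x r) (fun x _ => ball_mem_nhds x hr)
  have : ν (sphere 0 1) = 0 := by
    refine measure_mono_null hcov ((measure_biUnion_null_iff t.countable_toSet).2 ?_)
    intro y hy
    have hyx : ‖y‖ = ‖x‖ := by
      have := ht y hy
      rw [mem_sphere_zero_iff_norm] at hx this
      rw [this, hx]
    have := measureReal_ball_eq hνi hyx r
    rw [h0, measureReal_eq_zero_iff] at this
    exact this
  apply hν0
  rw [← Measure.measure_univ_eq_zero, ← union_compl_self (sphere (0 : E n) 1)]
  exact measure_union_null this hν

theorem abs_integral_sub_integral_le {n : ℕ} {μ ν : Measure (E n)} [IsFiniteMeasure μ]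
    [IsFiniteMeasure ν] (hμ : μ (sphere 0 1)ᶜ = 0) (hν : ν (sphere 0 1)ᶜ = 0)
    (φ : BoundedContinuousFunction (E n) ℝ) {ε r a b : ℝ}
    (ha : ∀ x ∈ sphere (0 : E n) 1, μ.real (ball x r) = a)
    (hb : ∀ x ∈ sphere (0 : E n) 1, ν.real (ball x r) = b)
    (hε : ∀ x ∈ sphere (0 : E n) 1, ∀ y ∈ sphere (0 : E n) 1, dist x y < r →
      |φ x - φ y| ≤ ε) :
    |b * ∫ x, φ x ∂μ - a * ∫ x, φ x ∂ν| ≤ ε * (b * μ.real univ) ∧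
      b * μ.real univ = a * ν.real univ := by
  set D : Set (E n × E n) := {p | dist p.1 p.2 < r} with hD
  have mD : MeasurableSet D := measurableSet_lt (by fun_prop) measurable_const
  have hμ' : ∀ᵐ x ∂μ, x ∈ sphere (0 : E n) 1 := by rwa [ae_iff]
  have hν' : ∀ᵐ x ∂ν, x ∈ sphere (0 : E n) 1 := by rwa [ae_iff]
  have int1 : ∀ ψ : BoundedContinuousFunction (E n) ℝ,
      Integrable (fun p : E n × E n => D.indicator (fun p => ψ p.1) p) (μ.prod ν) := by
    intro ψ
    refine Integrable.indicator ?_ mD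
    refine Integrable.of_bound (by fun_prop) ‖ψ‖ (.of_forall fun p => ψ.norm_coe_le_norm _)
  have int2 : ∀ ψ : BoundedContinuousFunction (E n) ℝ,
      Integrable (fun p : E n × E n => D.indicator (fun p => ψ p.2) p) (μ.prod ν) := by
    intro ψ
    refine Integrable.indicator ?_ mD
    refine Integrable.of_bound (by fun_prop) ‖ψ‖ (.of_forall fun p => ψ.norm_coe_le_norm _)
  have e1 : ∀ ψ : BoundedContinuousFunction (E n) ℝ,
      ∫ p, D.indicator (fun p => ψ p.1) p ∂(μ.prod ν) = b * ∫ x, ψ x ∂μ := by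
    intro ψ
    rw [integral_prod _ (int1 ψ), ← integral_const_mul]
    refine integral_congr_ae ?_
    filter_upwards [hμ'] with x hx
    have : (fun y => D.indicator (fun p : E n × E n => ψ p.1) (x, y)) =
        (ball x r).indicator (fun _ => ψ x) := by
      ext y
      simp only [hD, indicator, mem_ofPred_eq, mem_ball, dist_comm]
    rw [this, integral_indicator measurableSet_ball]
    simp [hb x hx]
  have e2 : ∀ ψ : BoundedContinuousFunction (E n) ℝ,
      ∫ p, D.indicator (fun p => ψ p.2) p ∂(μ.prod ν) = a * ∫ x, ψ x ∂ν := by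
    intro ψ
    rw [integral_prod_symm _ (int2 ψ), ← integral_const_mul]
    refine integral_congr_ae ?_
    filter_upwards [hν'] with x hx
    have : (fun y => D.indicator (fun p : E n × E n => ψ p.2) (y, x)) =
        (ball x r).indicator (fun _ => ψ x) := by
      ext y
      simp only [hD, indicator, mem_ofPred_eq, mem_ball]
    rw [this, integral_indicator measurableSet_ball]
    simp [ha x hx]
  have hone : b * μ.real univ = a * ν.real univ := by
    have h1 := e1 (BoundedContinuousFunction.const _ 1)
    have h2 := e2 (BoundedContinuousFunction.const _ 1)
    simp only [BoundedContinuousFunction.const_apply, integral_const, smul_eq_mul, mul_one]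
      at h1 h2
    rw [← h1, ← h2]
  refine ⟨?_, hone⟩
  rw [← e1 φ, ← e2 φ, ← integral_sub (int1 φ) (int2 φ)]
  have h1 := e1 (BoundedContinuousFunction.const _ ε)
  simp only [BoundedContinuousFunction.const_apply, integral_const, smul_eq_mul] at h1
  have h1' : ε * (b * μ.real univ) = ∫ p, D.indicator (fun _ => ε) p ∂(μ.prod ν) := by
    rw [h1]; ring
  rw [h1', ← Real.norm_eq_abs]
  refine norm_integral_le_of_norm_le ((integrable_const ε).indicator mD) ?_
  have hp : ∀ᵐ p ∂(μ.prod ν), p.1 ∈ sphere (0 : E n) 1 ∧ p.2 ∈ sphere (0 : E n) 1 :=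
    (Measure.quasiMeasurePreserving_fst.ae hμ').and (Measure.quasiMeasurePreserving_snd.ae hν')
  filter_upwards [hp] with p hp
  by_cases hpD : p ∈ D
  · simpa [hpD] using hε _ hp.1 _ hp.2 hpD
  · simp [hpD]

/-- A finite rotation-invariant measure on the unit sphere is unique up to scaling. -/
theorem exists_eq_smul_of_isometry_invariant {n : ℕ} {μ ν : Measure (E n)} [IsFiniteMeasure μ]
    [IsFiniteMeasure ν] (hμ : μ (sphere 0 1)ᶜ = 0) (hν : ν (sphere 0 1)ᶜ = 0)
    (hμi : ∀ e : E n ≃ₗᵢ[ℝ] E n, μ.map e = μ) (hνi : ∀ e : E n ≃ₗᵢ[ℝ] E n, ν.map e = ν)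
    (hμ0 : μ ≠ 0) (hν0 : ν ≠ 0) : ∃ c : ℝ, 0 < c ∧ μ = ENNReal.ofReal c • ν := by
  have hM : 0 < μ.real univ := by
    rw [measureReal_def, ENNReal.toReal_pos_iff]
    exact ⟨Measure.measure_univ_pos.2 hμ0, measure_lt_top _ _⟩
  have hN : 0 < ν.real univ := by
    rw [measureReal_def, ENNReal.toReal_pos_iff]
    exact ⟨Measure.measure_univ_pos.2 hν0, measure_lt_top _ _⟩
  obtain ⟨x₀, hx₀⟩ : (sphere (0 : E n) 1).Nonempty := NormedSpace.sphere_nonempty.2 zero_le_one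
  have norm_eq : ∀ x ∈ sphere (0 : E n) 1, ‖x‖ = ‖x₀‖ := by
    intro x hx
    rw [mem_sphere_zero_iff_norm] at hx hx₀
    rw [hx, hx₀]
  refine ⟨μ.real univ / ν.real univ, by positivity, ?_⟩
  have := Measure.smul_finite ν (ENNReal.ofReal_ne_top (r := μ.real univ / ν.real univ))
  refine ext_of_forall_integral_eq_of_IsFiniteMeasure fun φ => ?_
  rw [integral_smul_measure, ENNReal.toReal_ofReal (by positivity), smul_eq_mul]
  refine eq_of_forall_dist_le fun ε hε => ?_
  have hε' : 0 < ε / μ.real univ := by positivity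
  obtain ⟨r, hr, hφ⟩ := Metric.uniformContinuousOn_iff.1
    ((isCompact_sphere (0 : E n) 1).uniformContinuousOn_of_continuous φ.continuous.continuousOn)
    _ hε'
  obtain ⟨h1, h2⟩ := abs_integral_sub_integral_le (ε := ε / μ.real univ) (r := r) hμ hν φ
    (fun x hx => measureReal_ball_eq hμi (norm_eq x hx) r)
    (fun x hx => measureReal_ball_eq hνi (norm_eq x hx) r)
    (fun x hx y hy hxy => by
      have := hφ x hx y hy hxy
      rw [Real.dist_eq] at this
      exact this.le)
  have hb := measureReal_ball_pos hν hνi hν0 hx₀ hr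
  set a := μ.real (ball x₀ r)
  set b := ν.real (ball x₀ r)
  have ha : a = b * (μ.real univ / ν.real univ) := by field_simp; linarith
  rw [ha, mul_assoc, ← mul_sub, abs_mul, abs_of_pos hb] at h1
  rw [Real.dist_eq]
  have e : ε / μ.real univ * (b * μ.real univ) = b * ε := by field_simp
  rw [e] at h1
  exact le_of_mul_le_mul_left h1 hb

/-- The radial projection of Lebesgue measure on the punctured unit ball to the unit sphere. -/
def sphereMeas (n : ℕ) : Measure (E n) :=
  (volume.restrict (ball 0 1 \ {0})).map fun x => ‖x‖⁻¹ • x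

theorem measurable_normalize {n : ℕ} : Measurable fun x : E n => ‖x‖⁻¹ • x := by fun_prop

instance {n : ℕ} : IsFiniteMeasure (sphereMeas n) := by
  have : IsFiniteMeasure (volume.restrict (ball (0 : E n) 1 \ {0})) := by
    refine isFiniteMeasure_restrict.2 ?_
    exact ((measure_mono sdiff_subset).trans_lt measure_ball_lt_top).ne
  unfold sphereMeas
  infer_instance

theorem sphereMeas_compl_sphere {n : ℕ} : sphereMeas n (sphere 0 1)ᶜ = 0 := by
  rw [sphereMeas, Measure.map_apply measurable_normalize isClosed_sphere.measurableSet.compl]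
  rw [Measure.restrict_apply (measurable_normalize isClosed_sphere.measurableSet.compl)]
  convert measure_empty (μ := (volume : Measure (E n)))
  ext x
  simp only [mem_inter_iff, mem_preimage, mem_compl_iff, mem_sphere_iff_norm, sub_zero, mem_sdiff,
    mem_ball, mem_singleton_iff, mem_empty_iff_false, iff_false, not_and]
  intro h h1 h2
  apply h
  rw [norm_smul, norm_inv, norm_norm, inv_mul_cancel₀ (norm_ne_zero_iff.2 h2)]

theorem ae_sphereMeas_mem_sphere {n : ℕ} : ∀ᵐ x ∂(sphereMeas n), x ∈ sphere (0 : E n) 1 := by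
  rw [ae_iff]; exact sphereMeas_compl_sphere

theorem sphereMeas_map {n : ℕ} (e : E n ≃ₗᵢ[ℝ] E n) : (sphereMeas n).map e = sphereMeas n := by
  have me : Measurable e := e.continuous.measurable
  rw [sphereMeas, Measure.map_map me measurable_normalize]
  have : (e ∘ fun x : E n => ‖x‖⁻¹ • x) = (fun x => ‖x‖⁻¹ • x) ∘ e := by
    ext1 x
    simp
  rw [this, ← Measure.map_map measurable_normalize me]
  congr 1
  have mp : MeasurePreserving e volume volume := e.measurePreserving
  have mr := mp.restrict_preimage (s := ball (0 : E n) 1 \ {0})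
    (measurableSet_ball.diff (measurableSet_singleton 0))
  have hpre : e ⁻¹' (ball (0 : E n) 1 \ {0}) = ball (0 : E n) 1 \ {0} := by
    ext x; simp
  rw [hpre] at mr
  exact mr.map_eq

theorem sphereMeas_univ {n : ℕ} : sphereMeas n univ = volume (ball (0 : E n) 1) := by
  rw [sphereMeas, Measure.map_apply measurable_normalize MeasurableSet.univ, preimage_univ,
    Measure.restrict_apply_univ, measure_sdiff_null (measure_singleton _)]

theorem sphereMeas_ne_zero {n : ℕ} : sphereMeas n ≠ 0 := by
  rw [← Measure.measure_univ_ne_zero, sphereMeas_univ]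
  exact (measure_ball_pos _ _ one_pos).ne'

theorem lintegral_sphereMeas {n : ℕ} {φ : E n → ℝ≥0∞} (hφ : Measurable φ) :
    ∫⁻ x, φ x ∂(sphereMeas n) = ∫⁻ x in ball (0 : E n) 1 \ {0}, φ (‖x‖⁻¹ • x) :=
  lintegral_map hφ measurable_normalize

theorem integrable_sphereMeas {n : ℕ} {φ : E n → ℝ} (hφ : ContinuousOn φ (sphere 0 1)) :
    Integrable φ (sphereMeas n) := by
  have e : (sphereMeas n).restrict (sphere 0 1) = sphereMeas n :=
    Measure.restrict_eq_self_of_ae_mem ae_sphereMeas_mem_sphere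
  have := hφ.integrableOn_compact (μ := sphereMeas n) (isCompact_sphere 0 1)
  rwa [IntegrableOn, e] at this

theorem eq_zero_of_integral_sphereMeas_eq_zero {n : ℕ} {φ : E n → ℝ}
    (hφ : ContinuousOn φ (sphere 0 1)) (h0 : ∀ x ∈ sphere (0 : E n) 1, 0 ≤ φ x)
    (hint : ∫ x, φ x ∂(sphereMeas n) = 0) : ∀ x ∈ sphere (0 : E n) 1, φ x = 0 := by
  intro x hx
  by_contra hne
  have hpos : 0 < φ x := lt_of_le_of_ne (h0 x hx) (Ne.symm hne)
  have hae : ∀ᵐ y ∂(sphereMeas n), 0 ≤ φ y := by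
    filter_upwards [ae_sphereMeas_mem_sphere] with y hy using h0 y hy
  have hz := (integral_eq_zero_iff_of_nonneg_ae hae (integrable_sphereMeas hφ)).1 hint
  have hnear := hφ x hx (Ioi_mem_nhds hpos)
  rw [Filter.mem_map, mem_nhdsWithin_iff] at hnear
  obtain ⟨r, hr, hsub⟩ := hnear
  refine (measureReal_ball_pos sphereMeas_compl_sphere sphereMeas_map sphereMeas_ne_zero
    hx hr).ne' ?_
  have hz' : ∀ᵐ y ∂(sphereMeas n), y ∉ ball x r := by
    filter_upwards [hz, ae_sphereMeas_mem_sphere] with y hy hyS hyb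
    have : 0 < φ y := hsub ⟨hyb, hyS⟩
    exact this.ne' hy
  rw [measureReal_eq_zero_iff]
  rwa [← compl_mem_ae_iff]

theorem lipschitzOnWith_normalize {V : Type*} [NormedAddCommGroup V] [NormedSpace ℝ V] :
    LipschitzOnWith 2 (fun x : V => ‖x‖⁻¹ • x) {x | 1 ≤ ‖x‖} := by
  refine LipschitzOnWith.of_dist_le_mul fun x (hx : 1 ≤ ‖x‖) y (hy : 1 ≤ ‖y‖) => ?_
  rw [dist_eq_norm, dist_eq_norm]
  have hx0 : 0 < ‖x‖ := by linarith
  have hy0 : 0 < ‖y‖ := by linarith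
  have e : ‖x‖⁻¹ • x - ‖y‖⁻¹ • y = ‖x‖⁻¹ • (x - y) + (‖x‖⁻¹ - ‖y‖⁻¹) • y := by
    rw [smul_sub, sub_smul]; abel
  have e2 : (‖x‖⁻¹ - ‖y‖⁻¹) * ‖y‖ = ‖x‖⁻¹ * (‖y‖ - ‖x‖) := by field_simp
  have h1 : ‖x‖⁻¹ ≤ 1 := inv_le_one_of_one_le₀ hx
  rw [e]
  calc ‖‖x‖⁻¹ • (x - y) + (‖x‖⁻¹ - ‖y‖⁻¹) • y‖
      ≤ ‖x‖⁻¹ * ‖x - y‖ + |(‖x‖⁻¹ - ‖y‖⁻¹) * ‖y‖| := by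
        refine (norm_add_le _ _).trans (le_of_eq ?_)
        rw [norm_smul, norm_smul, norm_inv, norm_norm, abs_mul, abs_norm, Real.norm_eq_abs]
    _ ≤ 1 * ‖x - y‖ + 1 * ‖x - y‖ := by
        rw [e2, abs_mul, abs_of_pos (inv_pos.2 hx0)]
        have h2 : |‖y‖ - ‖x‖| ≤ ‖x - y‖ := by
          rw [norm_sub_rev]; exact abs_norm_sub_norm_le y x
        gcongr
    _ = _ := by push_cast; ring

theorem hausdorffMeasure_sphere_lt_top {n : ℕ} : μH[(n : ℝ)] (sphere (0 : E n) 1) < ⊤ := by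
  set Q : Set (Fin n → ℝ) := closedBall 0 1 with hQ
  set ψ : Fin (n + 1) → ℝ → (Fin n → ℝ) → E n := fun i s z =>
    WithLp.toLp 2 (i.insertNth s z : Fin (n + 1) → ℝ) with hψ
  have cover : sphere (0 : E n) 1 ⊆ ⋃ i : Fin (n + 1), ⋃ b : Bool,
      ((fun x : E n => ‖x‖⁻¹ • x) ∘ ψ i (cond b 1 (-1))) '' Q := by
    intro x hx
    obtain ⟨i, hi⟩ := Finite.exists_max fun i => |x i|
    have hxi : 0 < |x i| := by
      by_contra hcon
      have : x = 0 := by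
        ext j
        have := (hi j).trans (not_lt.1 hcon)
        simpa using this
      simp [this] at hx
    have hx1 : ‖x‖ = 1 := by simpa using hx
    obtain ⟨b, hb⟩ : ∃ b : Bool, (cond b 1 (-1) : ℝ) = |x i|⁻¹ * x i := by
      rcases le_total 0 (x i) with h | h
      · rw [abs_of_nonneg h] at hxi ⊢
        exact ⟨true, by field_simp; simp⟩
      · rw [abs_of_nonpos h] at hxi ⊢
        refine ⟨false, ?_⟩
        have : x i ≠ 0 := by linarith
        field_simp; simp
    simp only [mem_iUnion]
    refine ⟨i, b, fun j => |x i|⁻¹ * x (i.succAbove j), ?_, ?_⟩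
    · rw [hQ, mem_closedBall_zero_iff, pi_norm_le_iff_of_nonneg zero_le_one]
      intro j
      rw [norm_mul, norm_inv, Real.norm_eq_abs, Real.norm_eq_abs, abs_abs, inv_mul_le_one₀ hxi]
      exact hi _
    · have : ψ i (cond b 1 (-1)) (fun j => |x i|⁻¹ * x (i.succAbove j)) = |x i|⁻¹ • x := by
        ext j
        rw [hψ, hb]
        refine Fin.succAboveCases i ?_ (fun k => ?_) j <;> simp
      simp only [Function.comp_apply, this]
      rw [norm_smul, hx1, norm_inv, Real.norm_eq_abs, abs_abs, smul_smul, mul_one, inv_inv,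
        mul_inv_cancel₀ hxi.ne', one_smul]
  refine (measure_mono cover).trans_lt ?_
  refine (measure_iUnion_le _).trans_lt ?_
  rw [tsum_fintype]
  refine ENNReal.sum_lt_top.2 fun i _ => ?_
  refine (measure_iUnion_le _).trans_lt ?_
  rw [tsum_fintype]
  refine ENNReal.sum_lt_top.2 fun b _ => ?_
  have lip1 : LipschitzWith 1 fun z : Fin n → ℝ =>
      (i.insertNth (cond b 1 (-1)) z : Fin (n + 1) → ℝ) := by
    refine LipschitzWith.of_dist_le_mul fun z w => ?_
    rw [NNReal.coe_one, one_mul, dist_pi_le_iff dist_nonneg]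
    intro j
    refine Fin.succAboveCases i ?_ (fun k => ?_) j
    · simp
    · simpa using dist_le_pi_dist z w k
  have lip2 := (PiLp.lipschitzWith_toLp 2 (fun _ : Fin (n + 1) => ℝ)).comp lip1
  have maps : MapsTo (ψ i (cond b 1 (-1))) Q {x | 1 ≤ ‖x‖} := by
    intro z _
    have h1 : ‖(ψ i (cond b 1 (-1)) z) i‖ ≤ ‖ψ i (cond b 1 (-1)) z‖ := PiLp.norm_apply_le _ i
    refine le_trans ?_ h1
    cases b <;> simp [hψ]
  have lip := lipschitzOnWith_normalize.comp lip2.lipschitzOnWith maps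
  refine (lip.hausdorffMeasure_image_le (Nat.cast_nonneg n)).trans_lt ?_
  have hvol : μH[(n : ℝ)] Q = volume Q := by
    have := hausdorffMeasure_pi_real (ι := Fin n)
    rw [Fintype.card_fin] at this
    rw [this]
  rw [hvol]
  refine ENNReal.mul_lt_top ?_ measure_closedBall_lt_top
  exact ENNReal.rpow_lt_top_of_nonneg (Nat.cast_nonneg n) ENNReal.coe_ne_top

theorem hausdorffMeasure_sphere_pos {n : ℕ} : 0 < μH[(n : ℝ)] (sphere (0 : E n) 1) := by
  set π : E n → Fin n → ℝ := fun x i => x i.succ with hπ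
  have lip : LipschitzWith 1 π := by
    refine LipschitzWith.of_dist_le_mul fun x y => ?_
    rw [NNReal.coe_one, one_mul, dist_pi_le_iff dist_nonneg]
    intro i
    have := PiLp.norm_apply_le (x - y) i.succ
    rw [dist_eq_norm, dist_eq_norm]
    exact this
  set U : Set (Fin n → ℝ) := {z | ∑ i, z i ^ 2 < 1} with hU
  have hUo : IsOpen U := isOpen_lt (by fun_prop) continuous_const
  have hU0 : U.Nonempty := ⟨0, by simp [hU]⟩
  have hsub : U ⊆ π '' sphere 0 1 := by
    intro z (hz : ∑ i, z i ^ 2 < 1)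
    refine ⟨WithLp.toLp 2 (Fin.cons √(1 - ∑ i, z i ^ 2) z : Fin (n + 1) → ℝ), ?_, ?_⟩
    · rw [mem_sphere_zero_iff_norm, EuclideanSpace.norm_eq, Real.sqrt_eq_one, Fin.sum_univ_succ]
      simp only [Fin.cons_zero, Fin.cons_succ, Real.norm_eq_abs, sq_abs]
      rw [Real.sq_sqrt (by linarith)]
      ring
    · ext i
      simp [hπ]
  have hvol : μH[(n : ℝ)] U = volume U := by
    have := hausdorffMeasure_pi_real (ι := Fin n)
    rw [Fintype.card_fin] at this
    rw [this]
  calc 0 < volume U := hUo.measure_pos _ hU0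
    _ = μH[(n : ℝ)] U := hvol.symm
    _ ≤ μH[(n : ℝ)] (π '' sphere 0 1) := measure_mono hsub
    _ ≤ μH[(n : ℝ)] (sphere (0 : E n) 1) := by
      simpa using lip.hausdorffMeasure_image_le (Nat.cast_nonneg n) (sphere (0 : E n) 1)

theorem exists_hausdorffMeasure_restrict_sphere_eq {n : ℕ} : ∃ c : ℝ, 0 < c ∧
    (μH[(n : ℝ)]).restrict (sphere (0 : E n) 1) = ENNReal.ofReal c • sphereMeas n := by
  have : IsFiniteMeasure ((μH[(n : ℝ)]).restrict (sphere (0 : E n) 1)) :=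
    isFiniteMeasure_restrict.2 hausdorffMeasure_sphere_lt_top.ne
  refine exists_eq_smul_of_isometry_invariant ?_ sphereMeas_compl_sphere ?_ sphereMeas_map ?_
    sphereMeas_ne_zero
  · rw [Measure.restrict_apply isClosed_sphere.measurableSet.compl, compl_inter_self,
      measure_empty]
  · intro e
    have mp : MeasurePreserving e (μH[(n : ℝ)]) μH[(n : ℝ)] :=
      e.toIsometryEquiv.measurePreserving_hausdorffMeasure _
    have mr := mp.restrict_preimage (s := sphere (0 : E n) 1) isClosed_sphere.measurableSet
    have hpre : e ⁻¹' (sphere (0 : E n) 1) = sphere (0 : E n) 1 := by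
      ext x; simp
    rw [hpre] at mr
    exact mr.map_eq
  · rw [Ne, Measure.restrict_eq_zero]
    exact hausdorffMeasure_sphere_pos.ne'

theorem exists_setIntegral_hausdorffMeasure_sphere_eq (n : ℕ) : ∃ c : ℝ, 0 < c ∧
    ∀ φ : E n → ℝ, ∫ x in sphere (0 : E n) 1, φ x ∂μH[(n : ℝ)] = c * ∫ x, φ x ∂sphereMeas n := by
  obtain ⟨c, hc, h⟩ := exists_hausdorffMeasure_restrict_sphere_eq (n := n)
  refine ⟨c, hc, fun φ => ?_⟩
  rw [h, integral_smul_measure, ENNReal.toReal_ofReal hc.le, smul_eq_mul]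

theorem Matrix.PosDef.exists_simultaneous_diagonalization {ι : Type*} [Fintype ι] [DecidableEq ι]
    {M B : Matrix ι ι ℝ} (hM : M.PosDef) (hB : B.IsHermitian) :
    ∃ (Q : Matrix ι ι ℝ) (l : ι → ℝ), Q.conjTranspose * M * Q = 1 ∧
      Q.conjTranspose * B * Q = Matrix.diagonal l := by
  set U := (hM.1.eigenvectorUnitary : Matrix ι ι ℝ) with hU
  set d := hM.1.eigenvalues with hd
  have hd0 : ∀ i, 0 < d i := hM.eigenvalues_pos
  have hUU : U.conjTranspose * U = 1 := by
    have := hM.1.eigenvectorUnitary.2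
    rw [Matrix.mem_unitaryGroup_iff'] at this
    exact this
  have hMs : M = U * Matrix.diagonal d * U.conjTranspose := by
    conv_lhs => rw [hM.1.spectral_theorem]
    rfl
  set D := Matrix.diagonal (fun i => (Real.sqrt (d i))⁻¹) with hD
  have h1 : (U * D).conjTranspose * M * (U * D) = 1 := by
    have hDt : D.conjTranspose = D := by simp [hD]
    have : (U * D).conjTranspose * M * (U * D) =
        D * (U.conjTranspose * U) * Matrix.diagonal d * (U.conjTranspose * U) * D := by
      rw [Matrix.conjTranspose_mul, hDt]
      nth_rewrite 1 [hMs]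
      simp only [Matrix.mul_assoc]
    rw [this, hUU, hD]
    simp only [Matrix.mul_one, Matrix.diagonal_mul_diagonal]
    rw [← Matrix.diagonal_one]
    congr 1
    funext i
    have := Real.sqrt_pos.2 (hd0 i)
    have h2 := Real.mul_self_sqrt (hd0 i).le
    field_simp
    nlinarith
  set P := U * D
  have hN : (P.conjTranspose * B * P).IsHermitian := Matrix.isHermitian_conjTranspose_mul_mul P hB
  set V := (hN.eigenvectorUnitary : Matrix ι ι ℝ) with hV
  have hVV : V.conjTranspose * V = 1 := by
    have := hN.eigenvectorUnitary.2
    rw [Matrix.mem_unitaryGroup_iff'] at this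
    exact this
  have hNs : P.conjTranspose * B * P = V * Matrix.diagonal hN.eigenvalues * V.conjTranspose := by
    conv_lhs => rw [hN.spectral_theorem]
    rfl
  refine ⟨P * V, hN.eigenvalues, ?_, ?_⟩
  · have : (P * V).conjTranspose * M * (P * V) =
        V.conjTranspose * (P.conjTranspose * M * P) * V := by
      rw [Matrix.conjTranspose_mul]; simp only [Matrix.mul_assoc]
    rw [this, h1, Matrix.mul_one, hVV]
  · have : (P * V).conjTranspose * B * (P * V) =
        V.conjTranspose * (P.conjTranspose * B * P) * V := by
      rw [Matrix.conjTranspose_mul]; simp only [Matrix.mul_assoc]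
    rw [this]
    conv_lhs => rw [hNs]
    have : V.conjTranspose * (V * Matrix.diagonal hN.eigenvalues * V.conjTranspose) * V =
        (V.conjTranspose * V) * Matrix.diagonal hN.eigenvalues * (V.conjTranspose * V) := by
      simp only [Matrix.mul_assoc]
    rw [this, hVV]; simp

theorem exists_det_add_smul_eq {V : Type*} [NormedAddCommGroup V] [InnerProductSpace ℝ V]
    [FiniteDimensional ℝ V] {M B : V →L[ℝ] V}
    (hMs : M.toLinearMap.IsSymmetric) (hMp : ∀ v ≠ 0, 0 < ⟪M v, v⟫)
    (hBs : B.toLinearMap.IsSymmetric) :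
    ∃ l : Fin (Module.finrank ℝ V) → ℝ, (∀ t : ℝ, (M + t • B).det = M.det * ∏ i, (1 + t * l i)) ∧
      0 < M.det ∧ (l = 0 → B = 0) := by
  set b := stdOrthonormalBasis ℝ V with hb
  set m := LinearMap.toMatrix b.toBasis b.toBasis M.toLinearMap with hm
  set k := LinearMap.toMatrix b.toBasis b.toBasis B.toLinearMap with hk
  have hmH : m.IsHermitian := (LinearMap.isHermitian_toMatrix_iff b).2 hMs
  have hkH : k.IsHermitian := (LinearMap.isHermitian_toMatrix_iff b).2 hBs
  have hmP : m.PosDef := by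
    refine Matrix.PosDef.of_dotProduct_mulVec_pos hmH fun v hv => ?_
    set w : V := b.repr.symm (WithLp.toLp 2 v) with hw
    have hwr : b.repr w = WithLp.toLp 2 v := by simp [hw]
    have h1 : b.repr (M w) = WithLp.toLp 2 (m.mulVec v) := by
      have h2 := LinearMap.toMatrix_mulVec_repr b.toBasis b.toBasis M.toLinearMap w
      have h3 : ∀ w : V, (b.toBasis.repr w : Fin (Module.finrank ℝ V) → ℝ) = (b.repr w).ofLp := by
        intro w; ext i; simp
      rw [h3, h3, hwr] at h2
      rw [hm]
      ext i
      exact (congrFun h2 i).symm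
    have h4 := hMp w (by simpa [hw] using hv)
    rw [← b.repr.inner_map_map, h1, hwr, EuclideanSpace.inner_eq_star_dotProduct] at h4
    simpa using h4
  obtain ⟨Q, l, h1, h2⟩ := hmP.exists_simultaneous_diagonalization hkH
  have hdet : ∀ t : ℝ, (M + t • B).det = (m + t • k).det := by
    intro t
    rw [ContinuousLinearMap.det, ← LinearMap.det_toMatrix b.toBasis]
    simp [hm, hk]
  have hdM : M.det = m.det := by
    have := hdet 0
    rwa [zero_smul, zero_smul, add_zero, add_zero] at this
  have hQ : Q.det * m.det * Q.det = 1 := by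
    have := congrArg Matrix.det h1
    simpa [Matrix.det_mul, Matrix.det_conjTranspose] using this
  have hQ0 : Q.det ≠ 0 := by rintro h; simp [h] at hQ
  refine ⟨l, fun t => ?_, ?_, fun hl => ?_⟩
  · have h3 : Q.conjTranspose * (m + t • k) * Q = Matrix.diagonal (fun i => 1 + t * l i) := by
      rw [Matrix.mul_add, Matrix.add_mul, h1, Matrix.mul_smul, Matrix.smul_mul, h2,
        ← Matrix.diagonal_one, ← Matrix.diagonal_smul, Matrix.diagonal_add]
      rfl
    have h4 := congrArg Matrix.det h3
    rw [Matrix.det_mul, Matrix.det_mul, Matrix.det_conjTranspose, Matrix.det_diagonal,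
      star_trivial] at h4
    rw [hdet, hdM, ← h4]
    linear_combination (-(m + t • k).det) * hQ
  · rw [hdM]; exact hmP.det_pos
  · have hu : IsUnit Q := by rw [Matrix.isUnit_iff_isUnit_det]; exact hQ0.isUnit
    have hu' : IsUnit Q.conjTranspose := by
      rw [Matrix.isUnit_iff_isUnit_det, Matrix.det_conjTranspose]; simpa using hQ0
    rw [hl] at h2
    have h5 : Matrix.diagonal (0 : Fin (Module.finrank ℝ V) → ℝ) = 0 := by ext; simp
    rw [h5, hu.mul_left_eq_zero, hu'.mul_right_eq_zero] at h2
    have : B.toLinearMap = 0 := by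
      apply (LinearMap.toMatrix b.toBasis b.toBasis).injective
      rw [← hk, h2, map_zero]
    ext1 v
    exact LinearMap.congr_fun this v

theorem exists_prod_one_add_mul_eq {ι : Type*} (s : Finset ι) (l : ι → ℝ) :
    ∃ q : Polynomial ℝ, ∀ t : ℝ, ∏ i ∈ s, (1 + t * l i) =
      1 + t * (∑ i ∈ s, l i) + t ^ 2 * (((∑ i ∈ s, l i) ^ 2 - ∑ i ∈ s, l i ^ 2) / 2) +
        t ^ 3 * q.eval t := by
  classical
  induction s using Finset.induction_on with
  | empty => exact ⟨0, fun t => by simp⟩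
  | insert a s ha ih =>
    obtain ⟨q, hq⟩ := ih
    refine ⟨q * (1 + Polynomial.X * Polynomial.C (l a)) +
      Polynomial.C (l a * (((∑ i ∈ s, l i) ^ 2 - ∑ i ∈ s, l i ^ 2) / 2)), fun t => ?_⟩
    rw [Finset.prod_insert ha, Finset.sum_insert ha, Finset.sum_insert ha, hq]
    simp only [Polynomial.eval_add, Polynomial.eval_mul, Polynomial.eval_one, Polynomial.eval_X,
      Polynomial.eval_C]
    ring

theorem contDiff_det {V : Type*} [NormedAddCommGroup V] [NormedSpace ℝ V] [FiniteDimensional ℝ V]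
    {k : WithTop ℕ∞} : ContDiff ℝ k (fun A : V →L[ℝ] V => A.det) := by
  set b := Module.finBasis ℝ V
  have : (fun A : V →L[ℝ] V => A.det) = fun A => ∑ σ : Equiv.Perm (Fin (Module.finrank ℝ V)),
      (Equiv.Perm.sign σ : ℝ) * ∏ i, b.coord (σ i) (A (b i)) := by
    funext A
    rw [ContinuousLinearMap.det, ← LinearMap.det_toMatrix b, Matrix.det_apply']
    simp [LinearMap.toMatrix_apply]
  rw [this]
  refine ContDiff.sum fun σ _ => contDiff_const.mul (contDiff_prod fun i _ => ?_)
  have : (fun A : V →L[ℝ] V => b.coord (σ i) (A (b i))) =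
      (LinearMap.toContinuousLinearMap (b.coord (σ i)) ∘L ContinuousLinearMap.apply ℝ V (b i)) := by
    funext A; simp
  rw [this]
  exact ContinuousLinearMap.contDiff _

section DetDerivative

variable {V : Type*} [NormedAddCommGroup V] [InnerProductSpace ℝ V] [FiniteDimensional ℝ V]

/-- The derivative of the determinant at `M` in the direction `B`. -/
def dDet (M B : V →L[ℝ] V) : ℝ := fderiv ℝ (fun A : V →L[ℝ] V => A.det) M B

/-- The second derivative of the determinant at `M` in the directions `B` and `C`. -/
def d2Det (M B C : V →L[ℝ] V) : ℝ := fderiv ℝ (fun A : V →L[ℝ] V => dDet A B) M C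

theorem dDet_add (M B C : V →L[ℝ] V) : dDet M (B + C) = dDet M B + dDet M C := map_add _ _ _

theorem dDet_smul (M B : V →L[ℝ] V) (a : ℝ) : dDet M (a • B) = a * dDet M B := map_smul _ _ _

theorem continuous_fderiv_det :
    Continuous (fderiv ℝ (fun A : V →L[ℝ] V => A.det)) :=
  (contDiff_det (k := 2)).continuous_fderiv (by norm_num)

theorem continuous_dDet : Continuous fun p : (V →L[ℝ] V) × (V →L[ℝ] V) => dDet p.1 p.2 :=
  (continuous_fderiv_det.comp continuous_fst).clm_apply continuous_snd

theorem differentiable_fderiv_det :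
    Differentiable ℝ (fderiv ℝ (fun A : V →L[ℝ] V => A.det)) :=
  ((contDiff_det (k := 2)).fderiv_right (m := 1) (by norm_num)).differentiable (by norm_num)

theorem d2Det_eq (M B C : V →L[ℝ] V) :
    d2Det M B C = fderiv ℝ (fderiv ℝ (fun A : V →L[ℝ] V => A.det)) M C B := by
  have := ((differentiable_fderiv_det M).hasFDerivAt.clm_apply (hasFDerivAt_const B M)).fderiv
  rw [d2Det]
  simp only [dDet]
  rw [this]
  simp

theorem continuous_d2Det :
    Continuous fun p : (V →L[ℝ] V) × (V →L[ℝ] V) × (V →L[ℝ] V) => d2Det p.1 p.2.1 p.2.2 := by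
  simp only [d2Det_eq]
  have : Continuous (fderiv ℝ (fderiv ℝ (fun A : V →L[ℝ] V => A.det))) :=
    ((contDiff_det (k := 2)).fderiv_right (m := 1) (by norm_num)).continuous_fderiv (by norm_num)
  exact ((this.comp continuous_fst).clm_apply continuous_snd.snd).clm_apply continuous_snd.fst

theorem d2Det_comm (M B C : V →L[ℝ] V) : d2Det M B C = d2Det M C B := by
  rw [d2Det_eq, d2Det_eq]
  exact ((contDiff_det (k := 2)).contDiffAt.isSymmSndFDerivAt (by simp)).eq C B

theorem hasDerivAt_det_add_smul (M B : V →L[ℝ] V) (t : ℝ) :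
    HasDerivAt (fun t : ℝ => (M + t • B).det) (dDet (M + t • B) B) t := by
  have h1 : HasDerivAt (fun t : ℝ => M + t • B) B t := by
    simpa using ((hasDerivAt_id t).smul_const B).const_add M
  have h2 := ((contDiff_det (k := 1)).differentiable (by norm_num) (M + t • B)).hasFDerivAt
  exact h2.comp_hasDerivAt t h1

theorem hasDerivAt_dDet_add_smul (M B C : V →L[ℝ] V) (t : ℝ) :
    HasDerivAt (fun t : ℝ => dDet (M + t • C) B) (d2Det (M + t • C) B C) t := by
  have h1 : HasDerivAt (fun t : ℝ => M + t • C) C t := by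
    simpa using ((hasDerivAt_id t).smul_const C).const_add M
  have h2 : DifferentiableAt ℝ (fun A : V →L[ℝ] V => dDet A B) (M + t • C) :=
    (differentiable_fderiv_det (M + t • C)).clm_apply (differentiableAt_const B)
  exact h2.hasFDerivAt.comp_hasDerivAt t h1

theorem dDet_eq_of_eventually {M B : V →L[ℝ] V} {f : ℝ → ℝ} {f' : ℝ}
    (h : ∀ t : ℝ, (M + t • B).det = f t) (hf : HasDerivAt f f' 0) : dDet M B = f' := by
  have h1 := hasDerivAt_det_add_smul M B 0
  rw [funext h, zero_smul, add_zero] at h1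
  exact h1.unique hf

theorem dDet_self (M : V →L[ℝ] V) : dDet M M = Module.finrank ℝ V * M.det := by
  have h : ∀ t : ℝ, (M + t • M).det = (1 + t) ^ Module.finrank ℝ V * M.det := by
    intro t
    have : M + t • M = (1 + t) • M := by rw [add_smul, one_smul]
    rw [this]
    exact LinearMap.det_smul _ _
  refine dDet_eq_of_eventually h ?_
  have := (((hasDerivAt_id (0 : ℝ)).const_add 1).pow (Module.finrank ℝ V)).mul_const M.det
  simpa using this

theorem det_one_add_smulRight (p q : V) :
    (1 + (innerSL ℝ q).smulRight p : V →L[ℝ] V).det = 1 + ⟪q, p⟫ := by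
  have h : (1 + (innerSL ℝ q).smulRight p : V →L[ℝ] V).toLinearMap =
      LinearMap.transvection (innerSL ℝ q).toLinearMap p := by
    ext v
    simp [LinearMap.transvection.apply]
  rw [ContinuousLinearMap.det, h, LinearMap.transvection.det]
  simp

theorem ContinuousLinearMap.det_comp (A B : V →L[ℝ] V) : (A ∘L B).det = A.det * B.det :=
  LinearMap.det_comp _ _

theorem inverse_apply_self {M : V →L[ℝ] V} (hM : M.det ≠ 0) (p : V) : M (M.inverse p) = p := by
  have h : M = ((M.toContinuousLinearEquivOfDetNeZero hM : V ≃L[ℝ] V) : V →L[ℝ] V) := by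
    ext v; simp
  rw [h, ContinuousLinearMap.inverse_equiv]
  simp only [ContinuousLinearEquiv.coe_coe, ContinuousLinearEquiv.apply_symm_apply]

theorem inverse_apply_eq {M : V →L[ℝ] V} (hM : M.det ≠ 0) {p q : V} (h : M q = p) :
    M.inverse p = q := by
  have h' : M = ((M.toContinuousLinearEquivOfDetNeZero hM : V ≃L[ℝ] V) : V →L[ℝ] V) := by
    ext v; simp
  rw [← h]
  nth_rewrite 1 [h']
  rw [ContinuousLinearMap.inverse_equiv]
  nth_rewrite 2 [h']
  simp only [ContinuousLinearEquiv.coe_coe, ContinuousLinearEquiv.symm_apply_apply]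

theorem dDet_smulRight_self {M : V →L[ℝ] V} (hM : M.det ≠ 0) (p : V) :
    dDet M ((innerSL ℝ p).smulRight p) = M.det * ⟪M.inverse p, p⟫ := by
  have h : ∀ t : ℝ, (M + t • (innerSL ℝ p).smulRight p).det =
      M.det * (1 + t * ⟪M.inverse p, p⟫) := by
    intro t
    have : M + t • (innerSL ℝ p).smulRight p =
        M ∘L (1 + (innerSL ℝ p).smulRight (t • M.inverse p)) := by
      ext v
      simp [inverse_apply_self hM, smul_smul, mul_comm]
    rw [this, ContinuousLinearMap.det_comp, det_one_add_smulRight, real_inner_smul_right,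
      real_inner_comm]
  refine dDet_eq_of_eventually h ?_
  have := (((hasDerivAt_id (0 : ℝ)).mul_const ⟪M.inverse p, p⟫).const_add 1).const_mul M.det
  simpa using this

theorem dDet_smulRight_of_apply_eq {M : V →L[ℝ] V} (hM : M.det ≠ 0) {x : V} (hx : ‖x‖ = 1)
    (hMx : M x = x) : dDet M ((innerSL ℝ x).smulRight x) = M.det := by
  rw [dDet_smulRight_self hM, inverse_apply_eq hM hMx, real_inner_self_eq_norm_sq, hx]
  ring

theorem dDet_of_add_smulRight {A : V →L[ℝ] V} {x : V} (hx : ‖x‖ = 1) (hAx : A x = 0)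
    (hM : (A + (innerSL ℝ x).smulRight x).det ≠ 0) :
    dDet (A + (innerSL ℝ x).smulRight x) A =
      (Module.finrank ℝ V - 1) * (A + (innerSL ℝ x).smulRight x).det := by
  set M := A + (innerSL ℝ x).smulRight x with hMdef
  have h1 := dDet_self M
  have hMx : M x = x := by simp [hMdef, hAx, hx]
  have h2 := dDet_smulRight_of_apply_eq hM hx hMx
  have h3 : dDet M M = dDet M A + dDet M ((innerSL ℝ x).smulRight x) := by
    rw [← dDet_add]
  linarith

theorem det_smul_add_smulRight {A : V →L[ℝ] V} {x p q : V} {b : ℝ} (hx : ‖x‖ = 1)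
    (hAx : A x = 0) (hAs : ∀ v, ⟪A v, x⟫ = 0) (hb : b ≠ 0) (hq : ⟪q, x⟫ = b) :
    (b • A + (innerSL ℝ q).smulRight p).det =
      b ^ Module.finrank ℝ V * ⟪p, x⟫ * (A + (innerSL ℝ x).smulRight x).det := by
  have key : b • A + (innerSL ℝ q).smulRight p =
      (1 + (innerSL ℝ x).smulRight (p - x)) ∘L ((A + (innerSL ℝ x).smulRight x) ∘L
        (b • (1 + (innerSL ℝ (b⁻¹ • q - x)).smulRight x))) := by
    ext v
    have h1 : ⟪x, x⟫ = 1 := by rw [real_inner_self_eq_norm_sq, hx]; norm_num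
    have h2 : ⟪x, A v⟫ = 0 := by rw [real_inner_comm]; exact hAs v
    simp only [add_apply, smul_apply, ContinuousLinearMap.smulRight_apply, innerSL_apply_apply,
      ContinuousLinearMap.comp_apply, one_apply_eq_self, map_add, map_smul, hAx,
      inner_sub_left, inner_smul_left, h1, h2, zero_add, RCLike.conj_to_real]
    have h3 : b * (⟪x, v⟫ + (b⁻¹ * ⟪q, v⟫ - ⟪x, v⟫)) = ⟪q, v⟫ := by field_simp; ring
    have h5 : ⟪q, v⟫ • p = (b * (⟪x, v⟫ + (b⁻¹ * ⟪q, v⟫ - ⟪x, v⟫))) • p := by rw [h3]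
    rw [h5]
    simp only [zero_smul, one_smul, add_sub_cancel, add_zero]
    module
  rw [key, ContinuousLinearMap.det_comp, ContinuousLinearMap.det_comp, det_one_add_smulRight]
  have h7 : (b • (1 + (innerSL ℝ (b⁻¹ • q - x)).smulRight x) : V →L[ℝ] V).det =
      b ^ Module.finrank ℝ V * (1 + (innerSL ℝ (b⁻¹ • q - x)).smulRight x : V →L[ℝ] V).det :=
    LinearMap.det_smul _ _
  rw [h7, det_one_add_smulRight, inner_sub_left, inner_sub_right, real_inner_smul_left, hq,
    real_inner_self_eq_norm_sq, hx, inv_mul_cancel₀ hb, real_inner_comm]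
  ring

theorem d2Det_self_nonpos {M B : V →L[ℝ] V} (hMs : M.toLinearMap.IsSymmetric)
    (hMp : ∀ v ≠ 0, 0 < ⟪M v, v⟫) (hBs : B.toLinearMap.IsSymmetric) (h0 : dDet M B = 0) :
    d2Det M B B ≤ 0 ∧ (d2Det M B B = 0 → B = 0) := by
  obtain ⟨l, hl, hpos, hl0⟩ := exists_det_add_smul_eq hMs hMp hBs
  obtain ⟨q, hq⟩ := exists_prod_one_add_mul_eq Finset.univ l
  set s := ∑ i, l i
  set r := (s ^ 2 - ∑ i, l i ^ 2) / 2 with hr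
  set P : Polynomial ℝ := Polynomial.C M.det * (1 + Polynomial.X * Polynomial.C s +
    Polynomial.X ^ 2 * Polynomial.C r + Polynomial.X ^ 3 * q) with hP
  have hdet : ∀ t : ℝ, (M + t • B).det = P.eval t := by
    intro t
    rw [hl, hq]
    simp only [hP, Polynomial.eval_add, Polynomial.eval_mul, Polynomial.eval_one,
      Polynomial.eval_pow, Polynomial.eval_X, Polynomial.eval_C]
  have hd1 : ∀ t : ℝ, dDet (M + t • B) B = P.derivative.eval t := by
    intro t
    have h := hasDerivAt_det_add_smul M B t
    rw [funext hdet] at h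
    exact h.unique (P.hasDerivAt t)
  have hd2 : d2Det M B B = P.derivative.derivative.eval 0 := by
    have h := hasDerivAt_dDet_add_smul M B B 0
    rw [funext hd1, zero_smul, add_zero] at h
    exact h.unique (P.derivative.hasDerivAt 0)
  have e1 : P.derivative.eval 0 = M.det * s := by simp [hP]
  have e2 : P.derivative.derivative.eval 0 = M.det * (2 * r) := by
    simp [hP]; left; ring
  have hs : s = 0 := by
    have := hd1 0
    rw [zero_smul, add_zero, h0, e1] at this
    exact (mul_eq_zero.1 this.symm).resolve_left hpos.ne'
  have hsum : 0 ≤ ∑ i, l i ^ 2 := Finset.sum_nonneg fun i _ => sq_nonneg _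
  rw [hd2, e2, hr, hs]
  refine ⟨by nlinarith, fun h => hl0 ?_⟩
  have h1 : ∑ i, l i ^ 2 = 0 := by
    rcases mul_eq_zero.1 h with h | h
    · exact absurd h hpos.ne'
    · linarith
  rw [Finset.sum_eq_zero_iff_of_nonneg fun i _ => sq_nonneg _] at h1
  funext i
  simpa using h1 i (Finset.mem_univ i)

end DetDerivative

section Hessian

open scoped ContDiff Topology

variable {V : Type*} [NormedAddCommGroup V] [InnerProductSpace ℝ V] [FiniteDimensional ℝ V]

/-- The Hessian of `f` on an arbitrary Euclidean space. -/
def hessian (f : V → ℝ) (x : V) : V →L[ℝ] V := fderiv ℝ (gradient f) x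

variable {f g : V → ℝ} {x : V}

theorem ContDiffOn.contDiffAt_ne_zero {W : Type*} [NormedAddCommGroup W] [NormedSpace ℝ W]
    {f : V → W} (hf : ContDiffOn ℝ ∞ f {0}ᶜ) (hx : x ≠ 0) : ContDiffAt ℝ ∞ f x :=
  hf.contDiffAt (isOpen_compl_singleton.mem_nhds hx)

theorem eventually_ne_zero (hx : x ≠ 0) : ∀ᶠ y in 𝓝 x, y ≠ (0 : V) :=
  isOpen_compl_singleton.mem_nhds hx

theorem ContDiffOn.differentiableAt_ne_zero {W : Type*} [NormedAddCommGroup W] [NormedSpace ℝ W]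
    {f : V → W} (hf : ContDiffOn ℝ ∞ f {0}ᶜ) (hx : x ≠ 0) : DifferentiableAt ℝ f x :=
  (hf.contDiffAt_ne_zero hx).differentiableAt (by simp)

theorem ContDiffOn.gradient_compl (hf : ContDiffOn ℝ ∞ f {0}ᶜ) :
    ContDiffOn ℝ ∞ (gradient f) {0}ᶜ :=
  (InnerProductSpace.toDual ℝ V).symm.toContinuousLinearEquiv.contDiff.comp_contDiffOn
    (hf.fderiv_of_isOpen isOpen_compl_singleton (by simp))

theorem ContDiffOn.hessian_compl (hf : ContDiffOn ℝ ∞ f {0}ᶜ) :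
    ContDiffOn ℝ ∞ (hessian f) {0}ᶜ :=
  hf.gradient_compl.fderiv_of_isOpen isOpen_compl_singleton (by simp)

theorem hasFDerivAt_hessian (hf : ContDiffOn ℝ ∞ f {0}ᶜ) (hx : x ≠ 0) :
    HasFDerivAt (gradient f) (hessian f x) x :=
  (hf.gradient_compl.differentiableAt_ne_zero hx).hasFDerivAt

theorem inner_hessian (hf : ContDiffOn ℝ ∞ f {0}ᶜ) (hx : x ≠ 0) (u v : V) :
    ⟪hessian f x u, v⟫ = fderiv ℝ (fderiv ℝ f) x u v := by
  have h1 : HasFDerivAt (fun y => ⟪gradient f y, v⟫) _ x :=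
    (hasFDerivAt_hessian hf hx).inner ℝ (hasFDerivAt_const v x)
  have h2 : DifferentiableAt ℝ (fderiv ℝ f) x :=
    (hf.fderiv_of_isOpen (m := ∞) isOpen_compl_singleton (by simp)).differentiableAt_ne_zero hx
  have h3 := h2.hasFDerivAt.clm_apply (hasFDerivAt_const v x)
  have h4 : (fun y => ⟪gradient f y, v⟫) = fun y => fderiv ℝ f y v := by
    funext y; exact inner_gradient_left
  rw [h4] at h1
  have := congrArg (fun T => T u) (h1.unique h3)
  simpa [fderivInnerCLM_apply] using this

theorem inner_hessian_comm (hf : ContDiffOn ℝ ∞ f {0}ᶜ) (hx : x ≠ 0) (u v : V) :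
    ⟪hessian f x u, v⟫ = ⟪u, hessian f x v⟫ := by
  rw [inner_hessian hf hx, real_inner_comm, inner_hessian hf hx]
  exact ((hf.contDiffAt_ne_zero hx).isSymmSndFDerivAt
    (by rw [minSmoothness_of_isRCLikeNormedField]; exact WithTop.coe_le_coe.2 le_top)).eq u v

theorem gradient_add_apply (hf : DifferentiableAt ℝ f x) (hg : DifferentiableAt ℝ g x) :
    gradient (fun y => f y + g y) x = gradient f x + gradient g x := by
  simp only [gradient]; rw [fderiv_fun_add hf hg, map_add]

theorem gradient_const_mul_apply (hf : DifferentiableAt ℝ f x) (c : ℝ) :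
    gradient (fun y => c * f y) x = c • gradient f x := by
  simp only [gradient]; rw [fderiv_const_mul hf, map_smul]

theorem gradient_mul_apply (hf : DifferentiableAt ℝ f x) (hg : DifferentiableAt ℝ g x) :
    gradient (fun y => f y * g y) x = f x • gradient g x + g x • gradient f x := by
  simp only [gradient]; rw [fderiv_fun_mul hf hg, map_add, map_smul, map_smul]

theorem hessian_add_apply (hf : ContDiffOn ℝ ∞ f {0}ᶜ) (hg : ContDiffOn ℝ ∞ g {0}ᶜ)
    (hx : x ≠ 0) : hessian (fun y => f y + g y) x = hessian f x + hessian g x := by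
  have h : gradient (fun y => f y + g y) =ᶠ[𝓝 x] fun y => gradient f y + gradient g y := by
    filter_upwards [eventually_ne_zero hx] with y hy
    exact gradient_add_apply (hf.differentiableAt_ne_zero hy) (hg.differentiableAt_ne_zero hy)
  rw [hessian, h.fderiv_eq]
  exact ((hasFDerivAt_hessian hf hx).add (hasFDerivAt_hessian hg hx)).fderiv

theorem hessian_const_mul_apply (hf : ContDiffOn ℝ ∞ f {0}ᶜ) (hx : x ≠ 0) (c : ℝ) :
    hessian (fun y => c * f y) x = c • hessian f x := by
  have h : gradient (fun y => c * f y) =ᶠ[𝓝 x] fun y => c • gradient f y := by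
    filter_upwards [eventually_ne_zero hx] with y hy
    exact gradient_const_mul_apply (hf.differentiableAt_ne_zero hy) c
  rw [hessian, h.fderiv_eq]
  exact ((hasFDerivAt_hessian hf hx).const_smul c).fderiv

theorem hessian_mul_apply (hf : ContDiffOn ℝ ∞ f {0}ᶜ) (hg : ContDiffOn ℝ ∞ g {0}ᶜ)
    (hx : x ≠ 0) : hessian (fun y => f y * g y) x = f x • hessian g x + g x • hessian f x +
      ((innerSL ℝ (gradient f x)).smulRight (gradient g x) +
        (innerSL ℝ (gradient g x)).smulRight (gradient f x)) := by
  have h : gradient (fun y => f y * g y) =ᶠ[𝓝 x]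
      fun y => f y • gradient g y + g y • gradient f y := by
    filter_upwards [eventually_ne_zero hx] with y hy
    exact gradient_mul_apply (hf.differentiableAt_ne_zero hy) (hg.differentiableAt_ne_zero hy)
  rw [hessian, h.fderiv_eq]
  have e := ((hf.differentiableAt_ne_zero hx).hasFDerivAt.smul (hasFDerivAt_hessian hg hx)).add
    ((hg.differentiableAt_ne_zero hx).hasFDerivAt.smul (hasFDerivAt_hessian hf hx))
  refine e.fderiv.trans ?_
  ext v
  simp only [add_apply, smul_apply, ContinuousLinearMap.smulRight_apply, innerSL_apply_apply,
    inner_gradient_left]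
  abel

/-- The commutator identity behind the carré du champ of the linearised determinant. -/
theorem hessian_sq_mul_apply (hf : ContDiffOn ℝ ∞ f {0}ᶜ) (hg : ContDiffOn ℝ ∞ g {0}ᶜ)
    (hx : x ≠ 0) : hessian (fun y => f y * (f y * g y)) x =
      (2 * f x) • hessian (fun y => f y * g y) x + (-(f x) ^ 2) • hessian g x +
        (2 * g x) • (innerSL ℝ (gradient f x)).smulRight (gradient f x) := by
  rw [hessian_mul_apply hf (hf.mul hg) hx, hessian_mul_apply hf hg hx,
    gradient_mul_apply (hf.differentiableAt_ne_zero hx) (hg.differentiableAt_ne_zero hx)]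
  ext v
  simp only [add_apply, smul_apply, ContinuousLinearMap.smulRight_apply, innerSL_apply_apply,
    inner_add_left, real_inner_smul_left]
  module

/-- Positively `1`-homogeneous functions that are smooth away from the origin. -/
structure IsHomog (f : V → ℝ) : Prop where
  map_smul : ∀ (t : ℝ) (x : V), 0 < t → f (t • x) = t * f x
  smooth : ContDiffOn ℝ ∞ f {0}ᶜ

theorem IsHomog.add (hf : IsHomog f) (hg : IsHomog g) : IsHomog fun y => f y + g y :=
  ⟨fun t x ht => by rw [hf.1 t x ht, hg.1 t x ht, mul_add], hf.2.add hg.2⟩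

theorem IsHomog.const_mul (hf : IsHomog f) (c : ℝ) : IsHomog fun y => c * f y :=
  ⟨fun t x ht => by rw [hf.1 t x ht]; ring, contDiffOn_const.mul hf.2⟩

theorem isHomog_norm : IsHomog fun x : V => ‖x‖ :=
  ⟨fun t x ht => by rw [norm_smul, Real.norm_of_nonneg ht.le],
    fun x hx => (contDiffAt_norm ℝ hx).contDiffWithinAt⟩

theorem contDiffOn_normalize : ContDiffOn ℝ ∞ (fun x : V => ‖x‖⁻¹ • x) {0}ᶜ :=
  (isHomog_norm.smooth.inv fun x (hx : x ≠ 0) => norm_ne_zero_iff.2 hx).smul contDiffOn_id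

theorem norm_normalize (hx : x ≠ 0) : ‖‖x‖⁻¹ • x‖ = 1 := by
  rw [norm_smul, norm_inv, norm_norm, inv_mul_cancel₀ (norm_ne_zero_iff.2 hx)]

theorem normalize_ne_zero (hx : x ≠ 0) : ‖x‖⁻¹ • x ≠ 0 := by
  rw [← norm_ne_zero_iff, norm_normalize hx]; norm_num

theorem normalize_smul {t : ℝ} (ht : 0 < t) (x : V) : ‖t • x‖⁻¹ • (t • x) = ‖x‖⁻¹ • x := by
  rw [norm_smul, Real.norm_of_nonneg ht.le, smul_smul, mul_inv]
  congr 1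
  field_simp

theorem ContDiffOn.comp_normalize (hf : ContDiffOn ℝ ∞ f {0}ᶜ) :
    ContDiffOn ℝ ∞ (fun x => f (‖x‖⁻¹ • x)) {0}ᶜ :=
  hf.comp contDiffOn_normalize fun _ hx => normalize_ne_zero hx

theorem IsHomog.comp_normalize_mul (hg : IsHomog g) (hf : ContDiffOn ℝ ∞ f {0}ᶜ) :
    IsHomog fun x => f (‖x‖⁻¹ • x) * g x :=
  ⟨fun t x ht => by rw [normalize_smul ht, hg.1 t x ht]; ring, hf.comp_normalize.mul hg.2⟩

theorem IsHomog.inner_gradient_self (hf : IsHomog f) (hx : x ≠ 0) :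
    ⟪gradient f x, x⟫ = f x := by
  rw [inner_gradient_left]
  have h1 : HasDerivAt (fun t : ℝ => f (t • x)) (fderiv ℝ f x x) 1 := by
    have h2 : HasDerivAt (fun t : ℝ => t • x) x 1 := by
      simpa using (hasDerivAt_id (1 : ℝ)).smul_const x
    have h3 : HasFDerivAt f (fderiv ℝ f x) ((1 : ℝ) • x) := by
      rw [one_smul]; exact (hf.2.differentiableAt_ne_zero hx).hasFDerivAt
    exact h3.comp_hasDerivAt (1 : ℝ) h2
  have h4 : HasDerivAt (fun t : ℝ => t * f x) (f x) 1 := by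
    simpa using (hasDerivAt_id (1 : ℝ)).mul_const (f x)
  refine h1.unique (h4.congr_of_eventuallyEq ?_)
  filter_upwards [lt_mem_nhds (zero_lt_one (α := ℝ))] with t ht
  exact hf.1 t x ht

theorem IsHomog.gradient_smul (hf : IsHomog f) (hx : x ≠ 0) {t : ℝ} (ht : 0 < t) :
    gradient f (t • x) = gradient f x := by
  have htx : t • x ≠ 0 := smul_ne_zero ht.ne' hx
  refine ext_inner_right ℝ fun v => ?_
  rw [inner_gradient_left, inner_gradient_left]
  have h1 : HasFDerivAt (fun y : V => t • y) (t • ContinuousLinearMap.id ℝ V) x :=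
    (hasFDerivAt_id x).const_smul t
  have h2 := (hf.2.differentiableAt_ne_zero htx).hasFDerivAt.comp x h1
  have h3 : (f ∘ fun y : V => t • y) = fun y => t * f y := by funext y; exact hf.1 t y ht
  rw [h3] at h2
  have h4 := (hf.2.differentiableAt_ne_zero hx).hasFDerivAt.const_mul t
  have h5 := congrArg (fun T => T v) (h2.unique h4)
  simp only [ContinuousLinearMap.comp_apply, smul_apply, ContinuousLinearMap.id_apply,
    smul_eq_mul] at h5
  rw [(fderiv ℝ f (t • x)).map_smul, smul_eq_mul] at h5
  exact mul_left_cancel₀ ht.ne' h5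

theorem IsHomog.hessian_apply_self (hf : IsHomog f) (hx : x ≠ 0) : hessian f x x = 0 := by
  have h1 : HasDerivAt (fun t : ℝ => gradient f (t • x)) (hessian f x x) 1 := by
    have h2 : HasDerivAt (fun t : ℝ => t • x) x 1 := by
      simpa using (hasDerivAt_id (1 : ℝ)).smul_const x
    have h3 : HasFDerivAt (gradient f) (hessian f x) ((1 : ℝ) • x) := by
      rw [one_smul]; exact hasFDerivAt_hessian hf.2 hx
    exact h3.comp_hasDerivAt (1 : ℝ) h2
  refine h1.unique ((hasDerivAt_const (1 : ℝ) (gradient f x)).congr_of_eventuallyEq ?_)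
  filter_upwards [lt_mem_nhds (zero_lt_one (α := ℝ))] with t ht
  exact hf.gradient_smul hx ht

theorem IsHomog.hessian_smul (hf : IsHomog f) (hx : x ≠ 0) {t : ℝ} (ht : 0 < t) :
    hessian f (t • x) = t⁻¹ • hessian f x := by
  have htx : t • x ≠ 0 := smul_ne_zero ht.ne' hx
  have h1 : HasFDerivAt (fun y : V => t • y) (t • ContinuousLinearMap.id ℝ V) x :=
    (hasFDerivAt_id x).const_smul t
  have h2 := (hasFDerivAt_hessian hf.2 htx).comp x h1
  have h3 : (gradient f ∘ fun y : V => t • y) =ᶠ[𝓝 x] gradient f := by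
    filter_upwards [eventually_ne_zero hx] with y hy
    exact hf.gradient_smul hy ht
  have h4 := (h2.congr_of_eventuallyEq h3.symm).unique (hasFDerivAt_hessian hf.2 hx)
  rw [← h4]
  ext v
  simp [smul_smul, inv_mul_cancel₀ ht.ne']

theorem IsHomog.inner_hessian_self (hf : IsHomog f) (hx : x ≠ 0) (v : V) :
    ⟪hessian f x v, x⟫ = 0 := by
  rw [inner_hessian_comm hf.2 hx, hf.hessian_apply_self hx, inner_zero_right]

/-- The gradient of the `0`-homogeneous extension is the tangential gradient. -/
theorem gradient_comp_normalize (hf : ContDiffOn ℝ ∞ f {0}ᶜ) (hx : ‖x‖ = 1) :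
    gradient (fun y => f (‖y‖⁻¹ • y)) x = gradient f x - ⟪gradient f x, x⟫ • x := by
  have hx0 : x ≠ 0 := by rintro rfl; simp at hx
  refine ext_inner_right ℝ fun v => ?_
  rw [inner_gradient_left]
  have hn : HasFDerivAt (fun y : V => ‖y‖) (innerSL ℝ x) x := by
    have h1 : DifferentiableAt ℝ (fun y : V => ‖y‖) x :=
      isHomog_norm.smooth.differentiableAt_ne_zero hx0
    have h2 := h1.hasFDerivAt.pow 2
    have h3 : HasFDerivAt (fun y : V => ‖y‖ ^ 2) (2 • innerSL ℝ x) x :=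
      (hasStrictFDerivAt_norm_sq x).hasFDerivAt
    have h4 := h2.unique h3
    have h5 : fderiv ℝ (fun y : V => ‖y‖) x = innerSL ℝ x := by
      ext w
      have := congrArg (fun T => T w) h4
      simp [hx] at this
      simpa using this
    rw [← h5]; exact h1.hasFDerivAt
  have hi : HasFDerivAt (fun y : V => ‖y‖⁻¹) (-innerSL ℝ x) x := by
    have h1 := (hasDerivAt_inv (norm_ne_zero_iff.2 hx0)).comp_hasFDerivAt x hn
    have h2 : HasFDerivAt (fun y : V => ‖y‖⁻¹) _ x := h1
    have h3 : -innerSL ℝ x = (-(‖x‖ ^ 2)⁻¹) • innerSL ℝ x := by rw [hx]; simp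
    rw [h3]; exact h2
  have hN : HasFDerivAt (fun y : V => ‖y‖⁻¹ • y) _ x := hi.smul (hasFDerivAt_id x)
  have h1 : ‖x‖⁻¹ • x = x := by simp [hx]
  have hfd : HasFDerivAt f (fderiv ℝ f x) (‖x‖⁻¹ • x) := by
    rw [h1]; exact (hf.differentiableAt_ne_zero hx0).hasFDerivAt
  have hc : HasFDerivAt (fun y => f (‖y‖⁻¹ • y)) _ x :=
    HasFDerivAt.comp (f := fun y : V => ‖y‖⁻¹ • y) (g := f) x hfd hN
  rw [hc.fderiv]
  simp only [ContinuousLinearMap.comp_apply, add_apply, ContinuousLinearMap.id_apply,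
    ContinuousLinearMap.smulRight_apply, neg_apply, innerSL_apply_apply, hx, inv_one, one_smul,
    map_add, map_smul, inner_sub_left, real_inner_smul_left, inner_gradient_left, smul_eq_mul]
  ring

end Hessian

section SupportFunction

open scoped ContDiff Topology

variable {V : Type*} [NormedAddCommGroup V] [InnerProductSpace ℝ V] [FiniteDimensional ℝ V]
variable {f g H : V → ℝ} {x : V}

/-- The operator whose determinant is the reciprocal Gauss curvature. -/
def curvOp (H : V → ℝ) (x : V) : V →L[ℝ] V := hessian H x + (innerSL ℝ x).smulRight x

/-- Support functions of smooth strictly convex bodies with the origin in the interior. -/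
structure IsSupport (H : V → ℝ) : Prop extends IsHomog H where
  pos : ∀ x, ‖x‖ = 1 → 0 < H x
  posDef : ∀ x v, ‖x‖ = 1 → v ≠ 0 → 0 < ⟪curvOp H x v, v⟫

/-- The interior of the convex body with support function `H`. -/
def openBody (H : V → ℝ) : Set V := {y | ∀ x, ‖x‖ = 1 → ⟪y, x⟫ < H x}

theorem ne_zero_of_norm_eq_one (hx : ‖x‖ = 1) : x ≠ 0 := by
  rintro rfl; simp at hx

theorem isSymmetric_curvOp (hf : ContDiffOn ℝ ∞ f {0}ᶜ) (hx : x ≠ 0) :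
    (curvOp f x).toLinearMap.IsSymmetric := by
  intro u v
  have := inner_hessian_comm hf hx u v
  simp only [curvOp, ContinuousLinearMap.coe_coe, add_apply, inner_add_left, inner_add_right, this,
    ContinuousLinearMap.smulRight_apply, innerSL_apply_apply, real_inner_smul_left,
    real_inner_smul_right, real_inner_comm u x]
  ring

theorem IsHomog.curvOp_apply_self (hf : IsHomog f) (hx : ‖x‖ = 1) : curvOp f x x = x := by
  simp [curvOp, hf.hessian_apply_self (ne_zero_of_norm_eq_one hx), hx]

theorem curvOp_add_const_mul (hf : ContDiffOn ℝ ∞ f {0}ᶜ) (hg : ContDiffOn ℝ ∞ g {0}ᶜ)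
    (hx : x ≠ 0) (t : ℝ) :
    curvOp (fun y => f y + t * g y) x = curvOp f x + t • hessian g x := by
  rw [curvOp, hessian_add_apply hf (contDiffOn_const.mul hg) hx, hessian_const_mul_apply hg hx,
    curvOp]
  abel

theorem isSupport_of_pos_of_inner_pos (hH : IsHomog H) (hpos : ∀ x, ‖x‖ = 1 → 0 < H x)
    (hconv : ∀ x v, ‖x‖ = 1 → ⟪v, x⟫ = 0 → v ≠ 0 → 0 < ⟪hessian H x v, v⟫) : IsSupport H := by
  refine ⟨hH, hpos, fun x v hx hv => ?_⟩
  have hx0 := ne_zero_of_norm_eq_one hx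
  have hxx : ⟪x, x⟫ = 1 := by rw [real_inner_self_eq_norm_sq, hx]; norm_num
  set a := ⟪x, v⟫ with ha
  set w := v - a • x with hw
  have hwx : ⟪w, x⟫ = 0 := by
    rw [hw, inner_sub_left, real_inner_smul_left, hxx, ha, real_inner_comm]; ring
  have hv' : v = w + a • x := by rw [hw]; abel
  have e : ⟪curvOp H x v, v⟫ = ⟪hessian H x w, w⟫ + a ^ 2 := by
    have h1 : hessian H x v = hessian H x w := by
      rw [hv', map_add, (hessian H x).map_smul, hH.hessian_apply_self hx0, smul_zero, add_zero]
    have h2 : ⟪hessian H x w, v⟫ = ⟪hessian H x w, w⟫ := by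
      rw [hv', inner_add_right, real_inner_smul_right, hH.inner_hessian_self hx0, mul_zero,
        add_zero]
    rw [curvOp, add_apply, inner_add_left, h1, h2]
    simp only [ContinuousLinearMap.smulRight_apply, innerSL_apply_apply, real_inner_smul_left]
    rw [← ha]; ring
  rw [e]
  by_cases hw0 : w = 0
  · have ha0 : a ≠ 0 := by
      rintro h
      rw [hw0, h, zero_smul, add_zero] at hv'
      exact hv hv'
    rw [hw0]
    simp only [map_zero, inner_zero_left, zero_add]
    positivity
  · have := hconv x w hx hwx hw0
    positivity

theorem IsSupport.det_pos (hH : IsSupport H) (hx : ‖x‖ = 1) : 0 < (curvOp H x).det := by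
  have hs := isSymmetric_curvOp hH.smooth (ne_zero_of_norm_eq_one hx)
  obtain ⟨_, _, h, _⟩ := exists_det_add_smul_eq hs (fun v hv => hH.posDef x v hx hv) hs
  exact h

theorem IsSupport.pos_of_ne_zero (hH : IsSupport H) (hx : x ≠ 0) : 0 < H x := by
  have h1 := hH.pos _ (norm_normalize hx)
  rw [hH.map_smul _ _ (inv_pos.2 (norm_pos_iff.2 hx))] at h1
  exact pos_of_mul_pos_right h1 (inv_nonneg.2 (norm_nonneg _))

theorem IsSupport.inner_hessian_pos (hH : IsSupport H) (hx : x ≠ 0) {v : V}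
    (hv : ∀ c : ℝ, v ≠ c • x) : 0 < ⟪hessian H x v, v⟫ := by
  have hr : 0 < ‖x‖⁻¹ := inv_pos.2 (norm_pos_iff.2 hx)
  set u := ‖x‖⁻¹ • x with hu
  have hu1 : ‖u‖ = 1 := norm_normalize hx
  have hu0 := ne_zero_of_norm_eq_one hu1
  have huu : ⟪u, u⟫ = 1 := by rw [real_inner_self_eq_norm_sq, hu1]; norm_num
  have h1 : hessian H x = ‖x‖⁻¹ • hessian H u := by
    rw [hu, hH.hessian_smul hx hr, smul_smul, mul_inv_cancel₀ hr.ne', one_smul]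
  set a := ⟪u, v⟫ with ha
  set w := v - a • u with hw
  have hw0 : w ≠ 0 := by
    rw [hw, sub_ne_zero, hu, smul_smul]
    exact hv _
  have huw : ⟪u, w⟫ = 0 := by
    rw [hw, inner_sub_right, real_inner_smul_right, huu, ha]; ring
  have hv' : v = w + a • u := by rw [hw]; abel
  have h3 := hH.posDef u w hu1 hw0
  rw [curvOp, add_apply, inner_add_left] at h3
  simp only [ContinuousLinearMap.smulRight_apply, innerSL_apply_apply, real_inner_smul_left,
    huw, mul_zero, add_zero] at h3
  have h4 : hessian H u v = hessian H u w := by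
    rw [hv', map_add, (hessian H u).map_smul, hH.hessian_apply_self hu0, smul_zero, add_zero]
  have h5 : ⟪hessian H u w, v⟫ = ⟪hessian H u w, w⟫ := by
    rw [hv', inner_add_right, real_inner_smul_right, hH.inner_hessian_self hu0, mul_zero, add_zero]
  rw [h1, smul_apply, real_inner_smul_left, h4, h5]
  positivity

theorem IsSupport.inner_gradient_lt (hH : IsSupport H) {z : V} (hz : ‖z‖ = 1) (hx : ‖x‖ = 1)
    (hxz : x ≠ z) : ⟪gradient H z, x⟫ < H x := by
  have hz0 := ne_zero_of_norm_eq_one hz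
  by_cases hneg : x = -z
  · rw [hneg, inner_neg_right, hH.inner_gradient_self hz0, ← hneg]
    have := hH.pos x hx
    have := hH.pos z hz
    linarith
  set d := x - z with hd
  have hpar : ∀ c : ℝ, x ≠ c • z := by
    intro c hc
    have h1 : |c| = 1 := by
      have := congrArg norm hc
      rwa [norm_smul, hx, hz, mul_one, Real.norm_eq_abs, eq_comm] at this
    rcases (abs_eq zero_le_one).1 h1 with h | h
    · exact hxz (by rw [hc, h, one_smul])
    · exact hneg (by rw [hc, h, neg_one_smul])
  have hzd : ∀ t ∈ Icc (0 : ℝ) 1, z + t • d ≠ 0 ∧ ∀ c : ℝ, d ≠ c • (z + t • d) := by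
    intro t ht
    constructor
    · intro h0
      have h1 : t • x = (t - 1) • z := by
        have : z + t • d = t • x - (t - 1) • z := by rw [hd]; module
        rw [this, sub_eq_zero] at h0
        exact h0
      by_cases htz : t = 0
      · rw [htz, zero_smul, zero_sub, neg_one_smul] at h1
        exact hz0 (neg_eq_zero.1 h1.symm)
      · apply hpar (t⁻¹ * (t - 1))
        rw [← smul_smul, ← h1, smul_smul, inv_mul_cancel₀ htz, one_smul]
    · intro c hc
      have h1 : (1 - c * t) • x = (1 + c - c * t) • z := by
        have : d - c • (z + t • d) = (1 - c * t) • x - (1 + c - c * t) • z := by rw [hd]; module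
        rw [← sub_eq_zero, ← this, sub_eq_zero]
        exact hc
      by_cases htz : 1 - c * t = 0
      · rw [htz, zero_smul, eq_comm, smul_eq_zero] at h1
        rcases h1 with h1 | h1
        · have : c = 0 := by linarith
          rw [this] at htz
          norm_num at htz
        · exact hz0 h1
      · apply hpar ((1 - c * t)⁻¹ * (1 + c - c * t))
        rw [← smul_smul, ← h1, smul_smul, inv_mul_cancel₀ htz, one_smul]
  have hline : ∀ t : ℝ, HasDerivAt (fun t : ℝ => z + t • d) d t := fun t => by
    simpa using ((hasDerivAt_id t).smul_const d).const_add z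
  have hd1 : ∀ t ∈ Icc (0 : ℝ) 1,
      HasDerivAt (fun t : ℝ => H (z + t • d)) ⟪gradient H (z + t • d), d⟫ t := by
    intro t ht
    rw [inner_gradient_left]
    exact (hH.smooth.differentiableAt_ne_zero (hzd t ht).1).hasFDerivAt.comp_hasDerivAt t (hline t)
  have hd2 : ∀ t ∈ Icc (0 : ℝ) 1, HasDerivAt (fun t : ℝ => ⟪gradient H (z + t • d), d⟫)
      ⟪hessian H (z + t • d) d, d⟫ t := by
    intro t ht
    have h1 : HasDerivAt (fun t : ℝ => gradient H (z + t • d)) (hessian H (z + t • d) d) t :=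
      HasFDerivAt.comp_hasDerivAt (l := gradient H) (f := fun t : ℝ => z + t • d) t
        (hasFDerivAt_hessian hH.smooth (hzd t ht).1) (hline t)
    simpa using h1.inner ℝ (hasDerivAt_const t d)
  obtain ⟨c, hc, hceq⟩ := exists_hasDerivAt_eq_slope (fun t : ℝ => H (z + t • d))
    (fun t => ⟪gradient H (z + t • d), d⟫) zero_lt_one
    (fun t ht => (hd1 t ht).continuousAt.continuousWithinAt)
    (fun t ht => hd1 t (Ioo_subset_Icc_self ht))
  obtain ⟨e, he, heeq⟩ := exists_hasDerivAt_eq_slope (fun t : ℝ => ⟪gradient H (z + t • d), d⟫)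
    (fun t => ⟪hessian H (z + t • d) d, d⟫) hc.1
    (fun t ht => (hd2 t ⟨ht.1, ht.2.trans hc.2.le⟩).continuousAt.continuousWithinAt)
    (fun t ht => hd2 t ⟨ht.1.le, ht.2.le.trans hc.2.le⟩)
  have hpos := hH.inner_hessian_pos (hzd e ⟨he.1.le, he.2.le.trans hc.2.le⟩).1
    (hzd e ⟨he.1.le, he.2.le.trans hc.2.le⟩).2
  simp only [zero_smul, add_zero, one_smul, sub_zero, div_one] at hceq heeq
  have hzx : z + d = x := by rw [hd]; abel
  rw [hzx] at hceq
  rw [heeq] at hpos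
  have h2 : ⟪gradient H z, d⟫ < ⟪gradient H (z + c • d), d⟫ := by
    have := (div_pos_iff_of_pos_right hc.1).1 hpos
    linarith
  rw [hceq] at h2
  have h3 : ⟪gradient H z, d⟫ = ⟪gradient H z, x⟫ - H z := by
    rw [hd, inner_sub_right, hH.inner_gradient_self hz0]
  linarith

theorem IsSupport.inner_gradient_le (hH : IsSupport H) {z : V} (hz : ‖z‖ = 1) (hx : ‖x‖ = 1) :
    ⟪gradient H z, x⟫ ≤ H x := by
  by_cases h : x = z
  · rw [h, hH.inner_gradient_self (ne_zero_of_norm_eq_one hz)]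
  · exact (hH.inner_gradient_lt hz hx h).le

theorem IsSupport.exists_eq_smul_gradient (hH : IsSupport H) {y : V} (hy : y ≠ 0) :
    ∃ (s : ℝ) (x : V), 0 < s ∧ ‖x‖ = 1 ∧ y = s • gradient H x := by
  have hne : (sphere (0 : V) 1).Nonempty := ⟨‖y‖⁻¹ • y, by simpa using norm_normalize hy⟩
  have hcont : ContinuousOn (fun x : V => ⟪y, x⟫ / H x) (sphere 0 1) := by
    refine ContinuousOn.div (by fun_prop) (hH.smooth.continuousOn.mono ?_) ?_
    · intro x hx
      exact ne_zero_of_norm_eq_one (by simpa using hx)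
    · intro x hx
      exact (hH.pos x (by simpa using hx)).ne'
  obtain ⟨x, hx, hmax⟩ := (isCompact_sphere (0 : V) 1).exists_isMaxOn hne hcont
  have hx1 : ‖x‖ = 1 := by simpa using hx
  have hx0 := ne_zero_of_norm_eq_one hx1
  set m := ⟪y, x⟫ / H x with hm
  have hle : ∀ z : V, z ≠ 0 → ⟪y, z⟫ ≤ m * H z := by
    intro z hz
    have h1 := hmax (show ‖z‖⁻¹ • z ∈ sphere (0 : V) 1 by simpa using norm_normalize hz)
    have h2 : ⟪y, ‖z‖⁻¹ • z⟫ / H (‖z‖⁻¹ • z) = ⟪y, z⟫ / H z := by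
      have hr : 0 < ‖z‖⁻¹ := inv_pos.2 (norm_pos_iff.2 hz)
      rw [real_inner_smul_right, hH.map_smul _ _ hr, mul_div_mul_left _ _ hr.ne']
    have h3 : ⟪y, z⟫ / H z ≤ m := by rw [← h2]; exact h1
    exact (div_le_iff₀ (hH.pos_of_ne_zero hz)).1 h3
  have hmpos : 0 < m := by
    have h1 := hle y hy
    have h2 : 0 < ⟪y, y⟫ := real_inner_self_pos.2 hy
    exact pos_of_mul_pos_left (h2.trans_le h1) (hH.pos_of_ne_zero hy).le
  refine ⟨m, x, hmpos, hx1, ?_⟩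
  have hloc : IsLocalMax (fun z : V => ⟪y, z⟫ - m * H z) x := by
    filter_upwards [eventually_ne_zero hx0] with z hz
    have h1 : m * H x = ⟪y, x⟫ := by
      rw [hm]
      field_simp [(hH.pos x hx1).ne']
    have := hle z hz
    rw [h1]
    linarith
  have hder : HasFDerivAt (fun z : V => ⟪y, z⟫ - m * H z)
      (innerSL ℝ y - m • fderiv ℝ H x) x :=
    (innerSL ℝ y).hasFDerivAt.sub ((hH.smooth.differentiableAt_ne_zero hx0).hasFDerivAt.const_mul m)
  have h0 := hloc.hasFDerivAt_eq_zero hder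
  refine ext_inner_right ℝ fun v => ?_
  have := congrArg (fun T => T v) h0
  simp only [sub_apply, smul_apply, innerSL_apply_apply, zero_apply, smul_eq_mul,
    sub_eq_zero] at this
  rw [this, real_inner_smul_left, inner_gradient_left]

theorem IsSupport.smul_gradient_mem_openBody (hH : IsSupport H) {s : ℝ} (hs : 0 < s)
    (hx : ‖x‖ = 1) : s • gradient H x ∈ openBody H ↔ s < 1 := by
  constructor
  · intro h
    have h1 := h x hx
    rw [real_inner_smul_left, hH.inner_gradient_self (ne_zero_of_norm_eq_one hx)] at h1
    have := hH.pos x hx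
    nlinarith
  · intro h z hz
    rw [real_inner_smul_left]
    have h1 := hH.inner_gradient_le hx hz
    have := hH.pos z hz
    nlinarith

theorem IsSupport.smul_gradient_inj (hH : IsSupport H) {s r : ℝ} {z : V} (hs : 0 < s) (hr : 0 < r)
    (hx : ‖x‖ = 1) (hz : ‖z‖ = 1) (h : s • gradient H x = r • gradient H z) : x = z ∧ s = r := by
  have key : ∀ {s r : ℝ} {x z : V}, 0 < r → ‖x‖ = 1 → ‖z‖ = 1 →
      s • gradient H x = r • gradient H z → x ≠ z → s < r := by
    intro s r x z hr hx hz h hne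
    have h1 := congrArg (fun y => ⟪y, x⟫) h
    simp only [real_inner_smul_left] at h1
    rw [hH.inner_gradient_self (ne_zero_of_norm_eq_one hx)] at h1
    have h2 := hH.inner_gradient_lt hz hx hne
    have := hH.pos x hx
    nlinarith
  have hxz : x = z := by
    by_contra hne
    exact lt_asymm (key hr hx hz h hne) (key hs hz hx h.symm (Ne.symm hne))
  refine ⟨hxz, ?_⟩
  rw [hxz] at h
  have h1 := congrArg (fun y => ⟪y, z⟫) h
  simp only [real_inner_smul_left] at h1
  rw [hH.inner_gradient_self (ne_zero_of_norm_eq_one hz)] at h1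
  exact mul_right_cancel₀ (hH.pos z hz).ne' h1

end SupportFunction

section Volume

open scoped ContDiff Topology
open Module

variable {V : Type*} [NormedAddCommGroup V] [InnerProductSpace ℝ V] [FiniteDimensional ℝ V]
variable {b H : V → ℝ}

/-- The part of the ray bundle over the Gauss map image that lies below the height `b`. -/
def radialSet (H b : V → ℝ) : Set V :=
  {y | ∃ (s : ℝ) (x : V), 0 < s ∧ ‖x‖ = 1 ∧ s < b x ∧ y = s • gradient H x}

theorem mem_ball_diff_zero_iff {y : V} : y ∈ ball (0 : V) 1 \ {0} ↔ ‖y‖ < 1 ∧ y ≠ 0 := by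
  simp

theorem IsHomog.apply_eq_norm_mul (hb : IsHomog b) {y : V} (hy : y ≠ 0) :
    b y = ‖y‖ * b (‖y‖⁻¹ • y) := by
  rw [hb.map_smul _ _ (inv_pos.2 (norm_pos_iff.2 hy)), ← mul_assoc,
    mul_inv_cancel₀ (norm_ne_zero_iff.2 hy), one_mul]

theorem IsHomog.gradient_normalize (hb : IsHomog b) {y : V} (hy : y ≠ 0) :
    gradient b (‖y‖⁻¹ • y) = gradient b y :=
  hb.gradient_smul hy (inv_pos.2 (norm_pos_iff.2 hy))

theorem image_smul_gradient (hH : IsHomog H) (hb : IsHomog b) (hbpos : ∀ x, ‖x‖ = 1 → 0 < b x) :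
    (fun y => b y • gradient H y) '' (ball 0 1 \ {0}) = radialSet H b := by
  ext z
  constructor
  · rintro ⟨y, hy, rfl⟩
    rw [mem_ball_diff_zero_iff] at hy
    have h1 := hbpos _ (norm_normalize hy.2)
    have h2 := norm_pos_iff.2 hy.2
    refine ⟨b y, ‖y‖⁻¹ • y, ?_, norm_normalize hy.2, ?_, ?_⟩
    · rw [hb.apply_eq_norm_mul hy.2]; positivity
    · rw [hb.apply_eq_norm_mul hy.2]; nlinarith
    · simp only [hH.gradient_normalize hy.2]
  · rintro ⟨s, x, hs, hx, hsb, rfl⟩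
    have hb0 := hbpos x hx
    have ht : 0 < s / b x := by positivity
    have hx0 := ne_zero_of_norm_eq_one hx
    refine ⟨(s / b x) • x, ?_, ?_⟩
    · rw [mem_ball_diff_zero_iff, norm_smul, hx, mul_one, Real.norm_eq_abs, abs_of_pos ht]
      exact ⟨(div_lt_one hb0).2 hsb, smul_ne_zero ht.ne' hx0⟩
    · simp only [hb.map_smul _ _ ht, hH.gradient_smul hx0 ht, div_mul_cancel₀ _ hb0.ne']

theorem injOn_smul_gradient (hH : IsSupport H) (hb : IsHomog b)
    (hbpos : ∀ x, ‖x‖ = 1 → 0 < b x) :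
    InjOn (fun y => b y • gradient H y) (ball 0 1 \ {0}) := by
  intro y hy z hz h
  rw [mem_ball_diff_zero_iff] at hy hz
  have e : ∀ {y : V}, y ≠ 0 → b y • gradient H y = b y • gradient H (‖y‖⁻¹ • y) := by
    intro y hy
    rw [hH.gradient_normalize hy]
  have hp : ∀ {y : V}, y ≠ 0 → 0 < b y := by
    intro y hy
    rw [hb.apply_eq_norm_mul hy]
    exact mul_pos (norm_pos_iff.2 hy) (hbpos _ (norm_normalize hy))
  have h' : b y • gradient H y = b z • gradient H z := h
  rw [e hy.2, e hz.2] at h'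
  obtain ⟨h1, h2⟩ := hH.smul_gradient_inj (hp hy.2) (hp hz.2) (norm_normalize hy.2)
    (norm_normalize hz.2) h'
  rw [hb.apply_eq_norm_mul hy.2, hb.apply_eq_norm_mul hz.2, h1] at h2
  have h3 := mul_right_cancel₀ (hbpos _ (norm_normalize hz.2)).ne' h2
  calc y = ‖y‖ • ‖y‖⁻¹ • y := by
        rw [smul_smul, mul_inv_cancel₀ (norm_ne_zero_iff.2 hy.2), one_smul]
    _ = z := by rw [h1, h3, smul_smul, mul_inv_cancel₀ (norm_ne_zero_iff.2 hz.2), one_smul]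

theorem hasFDerivAt_smul_gradient (hH : IsHomog H) (hb : IsHomog b) {y : V} (hy : y ≠ 0) :
    HasFDerivAt (fun y => b y • gradient H y)
      (b (‖y‖⁻¹ • y) • hessian H (‖y‖⁻¹ • y) +
        (innerSL ℝ (gradient b (‖y‖⁻¹ • y))).smulRight (gradient H (‖y‖⁻¹ • y))) y := by
  have h1 : HasFDerivAt b (innerSL ℝ (gradient b y)) y := by
    have : innerSL ℝ (gradient b y) = fderiv ℝ b y := by
      ext v
      rw [innerSL_apply_apply, inner_gradient_left]
    rw [this]
    exact (hb.smooth.differentiableAt_ne_zero hy).hasFDerivAt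
  have h2 := h1.smul (hasFDerivAt_hessian hH.smooth hy)
  have h3 := inv_pos.2 (norm_pos_iff.2 hy)
  rw [hb.gradient_normalize hy, hH.gradient_normalize hy, hH.hessian_smul hy h3,
    hb.map_smul _ _ h3, smul_smul, mul_right_comm, mul_inv_cancel₀ h3.ne', one_mul]
  exact h2

theorem det_smul_hessian_add {x : V} (hH : IsHomog H) (hb : IsHomog b) (hx : ‖x‖ = 1)
    (hbx : b x ≠ 0) :
    (b x • hessian H x + (innerSL ℝ (gradient b x)).smulRight (gradient H x)).det =
      b x ^ finrank ℝ V * (H x * (curvOp H x).det) := by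
  have hx0 := ne_zero_of_norm_eq_one hx
  rw [det_smul_add_smulRight hx (hH.hessian_apply_self hx0) (hH.inner_hessian_self hx0) hbx
    (hb.inner_gradient_self hx0), hH.inner_gradient_self hx0, mul_assoc]
  rfl

theorem openBody_diff_zero (hH : IsSupport H) :
    openBody H \ {0} = radialSet H fun x => ‖x‖ := by
  ext y
  constructor
  · rintro ⟨hy, hy0⟩
    obtain ⟨s, x, hs, hx, rfl⟩ := hH.exists_eq_smul_gradient hy0
    exact ⟨s, x, hs, hx, by simpa [hx] using (hH.smul_gradient_mem_openBody hs hx).1 hy, rfl⟩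
  · rintro ⟨s, x, hs, hx, h, rfl⟩
    simp only [hx] at h
    refine ⟨(hH.smul_gradient_mem_openBody hs hx).2 h, ?_⟩
    rintro h0
    have h1 := congrArg (fun y => ⟪y, x⟫) (show s • gradient H x = 0 from h0)
    simp only [real_inner_smul_left, hH.inner_gradient_self (ne_zero_of_norm_eq_one hx),
      inner_zero_left] at h1
    exact (mul_pos hs (hH.pos x hx)).ne' h1

theorem openBody_diff_zero_subset {K : V → ℝ} (hH : IsSupport H)
    (hb : ∀ x, ‖x‖ = 1 → b x = K x / H x) :
    openBody K \ {0} ⊆ radialSet H b := by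
  rintro y ⟨hy, hy0⟩
  obtain ⟨s, x, hs, hx, rfl⟩ := hH.exists_eq_smul_gradient hy0
  refine ⟨s, x, hs, hx, ?_, rfl⟩
  have h1 := hy x hx
  rw [real_inner_smul_left, hH.inner_gradient_self (ne_zero_of_norm_eq_one hx)] at h1
  rw [hb x hx]
  exact (lt_div_iff₀ (hH.pos x hx)).2 h1

variable [MeasurableSpace V] [BorelSpace V]

theorem measurableSet_radialSet (hH : IsSupport H) (hb : IsHomog b)
    (hbpos : ∀ x, ‖x‖ = 1 → 0 < b x) : MeasurableSet (radialSet H b) := by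
  rw [← image_smul_gradient hH.toIsHomog hb hbpos]
  exact measurable_image_of_fderivWithin
    (measurableSet_ball.diff (measurableSet_singleton _))
    (fun y hy => (hasFDerivAt_smul_gradient hH.toIsHomog hb
      (mem_ball_diff_zero_iff.1 hy).2).hasFDerivWithinAt) (injOn_smul_gradient hH hb hbpos)

theorem addHaar_radialSet (μ : Measure V) [μ.IsAddHaarMeasure] (hH : IsSupport H) (hb : IsHomog b)
    (hbpos : ∀ x, ‖x‖ = 1 → 0 < b x) :
    μ (radialSet H b) = ∫⁻ y in ball 0 1 \ {0}, ENNReal.ofReal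
      (b (‖y‖⁻¹ • y) ^ finrank ℝ V *
        (H (‖y‖⁻¹ • y) * (curvOp H (‖y‖⁻¹ • y)).det)) ∂μ := by
  have hm : MeasurableSet (ball (0 : V) 1 \ {0}) :=
    measurableSet_ball.diff (measurableSet_singleton _)
  rw [← image_smul_gradient hH.toIsHomog hb hbpos,
    ← lintegral_abs_det_fderiv_eq_addHaar_image μ hm (fun y hy =>
      (hasFDerivAt_smul_gradient hH.toIsHomog hb
      (mem_ball_diff_zero_iff.1 hy).2).hasFDerivWithinAt) (injOn_smul_gradient hH hb hbpos)]
  refine setLIntegral_congr_fun hm fun y hy => ?_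
  have hy0 := (mem_ball_diff_zero_iff.1 hy).2
  have hn := norm_normalize hy0
  have h1 := hbpos _ hn
  have h2 := hH.pos _ hn
  have h3 := hH.det_pos hn
  rw [det_smul_hessian_add hH.toIsHomog hb hn h1.ne', abs_of_pos (by positivity)]

end Volume

section SphereVolume

open scoped ContDiff Topology

theorem ContDiffOn.continuousOn_hessian {V : Type*} [NormedAddCommGroup V] [InnerProductSpace ℝ V]
    [FiniteDimensional ℝ V] {f : V → ℝ} (hf : ContDiffOn ℝ ∞ f {0}ᶜ) :
    ContinuousOn (hessian f) {0}ᶜ := hf.hessian_compl.continuousOn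

theorem ContDiffOn.continuousOn_curvOp {V : Type*} [NormedAddCommGroup V] [InnerProductSpace ℝ V]
    [FiniteDimensional ℝ V] {f : V → ℝ} (hf : ContDiffOn ℝ ∞ f {0}ᶜ) :
    ContinuousOn (curvOp f) {0}ᶜ := by
  have h : Continuous fun x : V => (innerSL ℝ x).smulRight x :=
    ((ContinuousLinearMap.smulRightL ℝ V V).continuous.comp (innerSL ℝ).continuous).clm_apply
      continuous_id
  exact hf.continuousOn_hessian.add h.continuousOn

theorem ContDiffOn.continuousOn_det_curvOp {V : Type*} [NormedAddCommGroup V]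
    [InnerProductSpace ℝ V] [FiniteDimensional ℝ V] {f : V → ℝ} (hf : ContDiffOn ℝ ∞ f {0}ᶜ) :
    ContinuousOn (fun x => (curvOp f x).det) {0}ᶜ :=
  (contDiff_det (k := 0)).continuous.comp_continuousOn hf.continuousOn_curvOp

variable {n : ℕ} {b H : E n → ℝ}

theorem sphere_subset_compl_zero : sphere (0 : E n) 1 ⊆ {0}ᶜ := by
  intro x hx
  exact ne_zero_of_norm_eq_one (by simpa using hx)

theorem lintegral_normalize_ball {φ : E n → ℝ} (hφ : ContinuousOn φ {0}ᶜ)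
    (h0 : ∀ x, ‖x‖ = 1 → 0 ≤ φ x) :
    ∫⁻ y in ball (0 : E n) 1 \ {0}, ENNReal.ofReal (φ (‖y‖⁻¹ • y)) =
      ENNReal.ofReal (∫ x, φ x ∂sphereMeas n) := by
  have hint := integrable_sphereMeas (hφ.mono sphere_subset_compl_zero)
  have hmeas : Measurable (({0}ᶜ : Set (E n)).indicator φ) := by
    classical
    rw [← piecewise_eq_indicator]
    exact hφ.measurable_piecewise continuousOn_const (measurableSet_singleton _).compl
  rw [ofReal_integral_eq_lintegral_ofReal hint
    (ae_sphereMeas_mem_sphere.mono fun x hx => h0 x (by simpa using hx))]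
  have h1 : ∫⁻ x, ENNReal.ofReal (φ x) ∂sphereMeas n =
      ∫⁻ x, ENNReal.ofReal (({0}ᶜ : Set (E n)).indicator φ x) ∂sphereMeas n := by
    refine lintegral_congr_ae (ae_sphereMeas_mem_sphere.mono fun x hx => ?_)
    simp only [indicator_of_mem (sphere_subset_compl_zero hx)]
  rw [h1, lintegral_sphereMeas hmeas.ennreal_ofReal]
  refine setLIntegral_congr_fun (measurableSet_ball.diff (measurableSet_singleton _))
    fun y hy => ?_
  have hy0 : ‖y‖⁻¹ • y ∈ ({0}ᶜ : Set (E n)) := normalize_ne_zero (mem_ball_diff_zero_iff.1 hy).2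
  simp only [indicator_of_mem hy0]

theorem volume_radialSet (hH : IsSupport H) (hb : IsHomog b) (hbpos : ∀ x, ‖x‖ = 1 → 0 < b x) :
    volume (radialSet H b) = ENNReal.ofReal
      (∫ x, b x ^ (n + 1) * (H x * (curvOp H x).det) ∂sphereMeas n) := by
  rw [addHaar_radialSet volume hH hb hbpos, finrank_euclideanSpace, Fintype.card_fin]
  refine lintegral_normalize_ball (φ := fun x => b x ^ (n + 1) * (H x * (curvOp H x).det))
    ((hb.smooth.continuousOn.pow _).mul
      (hH.smooth.continuousOn.mul hH.smooth.continuousOn_det_curvOp)) fun x hx => ?_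
  have h1 := hbpos _ hx
  have h2 := hH.pos _ hx
  have h3 := hH.det_pos hx
  positivity

/-- Up to normalization, the volume of the convex body with support function `H`. -/
def coneVolume (H : E n → ℝ) : ℝ := ∫ x, H x * (curvOp H x).det ∂sphereMeas n

theorem coneVolume_nonneg (hH : IsSupport H) : 0 ≤ coneVolume H :=
  integral_nonneg_of_ae (ae_sphereMeas_mem_sphere.mono fun x hx =>
    (mul_pos (hH.pos x (by simpa using hx)) (hH.det_pos (by simpa using hx))).le)

theorem volume_radialSet_norm (hH : IsSupport H) :
    volume (radialSet H fun x => ‖x‖) = ENNReal.ofReal (coneVolume H) := by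
  rw [volume_radialSet hH isHomog_norm (fun x hx => by simp [hx]), coneVolume]
  congr 1
  refine integral_congr_ae (ae_sphereMeas_mem_sphere.mono fun x hx => ?_)
  have hx' : ‖x‖ = 1 := by simpa using hx
  simp only [hx', one_pow, one_mul]

theorem volume_openBody (hH : IsSupport H) :
    volume (openBody H) = ENNReal.ofReal (coneVolume H) := by
  rw [← volume_radialSet_norm hH, ← openBody_diff_zero hH,
    measure_sdiff_null (measure_singleton _)]

theorem measurableSet_openBody (hH : IsSupport H) : MeasurableSet (openBody H) := by
  have h0 : (0 : E n) ∈ openBody H := by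
    intro x hx
    rw [inner_zero_left]
    exact hH.pos x hx
  have h1 : openBody H = radialSet H (fun x => ‖x‖) ∪ {0} := by
    rw [← openBody_diff_zero hH, sdiff_union_of_subset (singleton_subset_iff.2 h0)]
  rw [h1]
  exact (measurableSet_radialSet hH isHomog_norm fun x hx => by simp [hx]).union
    (measurableSet_singleton _)

theorem coneVolume_le (hH : IsSupport H) {K : E n → ℝ} (hK : IsSupport K) :
    coneVolume K ≤ ∫ x, (K x / H x) ^ (n + 1) * (H x * (curvOp H x).det) ∂sphereMeas n := by
  have hbs : ContDiffOn ℝ ∞ (fun x => K x / H x) {0}ᶜ :=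
    hK.smooth.div hH.smooth fun x hx => (hH.pos_of_ne_zero hx).ne'
  have hb : IsHomog fun x => K (‖x‖⁻¹ • x) / H (‖x‖⁻¹ • x) * ‖x‖ :=
    isHomog_norm.comp_normalize_mul hbs
  have hb1 : ∀ x : E n, ‖x‖ = 1 → K (‖x‖⁻¹ • x) / H (‖x‖⁻¹ • x) * ‖x‖ = K x / H x := by
    intro x hx
    rw [hx, inv_one, one_smul, mul_one]
  have hbpos : ∀ x : E n, ‖x‖ = 1 → 0 < K (‖x‖⁻¹ • x) / H (‖x‖⁻¹ • x) * ‖x‖ := by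
    intro x hx
    rw [hb1 x hx]
    exact div_pos (hK.pos x hx) (hH.pos x hx)
  have h1 : ENNReal.ofReal (coneVolume K) ≤ _ :=
    calc ENNReal.ofReal (coneVolume K) = volume (openBody K \ {0}) := by
          rw [measure_sdiff_null (measure_singleton _), volume_openBody hK]
      _ ≤ volume (radialSet H fun x => K (‖x‖⁻¹ • x) / H (‖x‖⁻¹ • x) * ‖x‖) :=
          measure_mono (openBody_diff_zero_subset hH hb1)
      _ = ENNReal.ofReal _ := volume_radialSet hH hb hbpos
  have h2 : ∫ x, (K (‖x‖⁻¹ • x) / H (‖x‖⁻¹ • x) * ‖x‖) ^ (n + 1) * (H x * (curvOp H x).det)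
        ∂sphereMeas n =
      ∫ x, (K x / H x) ^ (n + 1) * (H x * (curvOp H x).det) ∂sphereMeas n := by
    refine integral_congr_ae (ae_sphereMeas_mem_sphere.mono fun x hx => ?_)
    simp only [hb1 x (by simpa using hx)]
  rw [h2] at h1
  refine (ENNReal.ofReal_le_ofReal_iff ?_).1 h1
  refine integral_nonneg_of_ae (ae_sphereMeas_mem_sphere.mono fun x hx => ?_)
  have hx' : ‖x‖ = 1 := by simpa using hx
  have := hH.pos x hx'
  have := hK.pos x hx'
  have := hH.det_pos hx'
  simp only [Pi.zero_apply]
  positivity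

theorem coneVolume_mul_le_sq {G : E n → ℝ} (hH : IsSupport H)
    {t : ℝ} (hp : IsSupport fun x => H x + t * G x) (hm : IsSupport fun x => H x + (-t) * G x) :
    coneVolume (fun x => H x + t * G x) * coneVolume (fun x => H x + (-t) * G x) ≤
      coneVolume H ^ 2 := by
  have h := volume_mul_volume_le_sq (measurableSet_openBody hp) (measurableSet_openBody hm)
    (measurableSet_openBody hH) fun y hy z hz x hx => by
      have h1 := hy x hx
      have h2 := hz x hx
      rw [real_inner_smul_left, inner_add_left]
      linarith
  rw [volume_openBody hp, volume_openBody hm, volume_openBody hH,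
    ← ENNReal.ofReal_mul (coneVolume_nonneg hp), ← ENNReal.ofReal_pow (coneVolume_nonneg hH)] at h
  exact (ENNReal.ofReal_le_ofReal_iff (by positivity)).1 h

end SphereVolume

section Perturbation

open scoped ContDiff Topology

theorem IsCompact.exists_forall_pos_add_mul {X : Type*} [TopologicalSpace X] {K : Set X}
    (hK : IsCompact K) {φ ψ : X → ℝ} (hφ : ContinuousOn φ K) (hψ : ContinuousOn ψ K)
    (hpos : ∀ p ∈ K, 0 < φ p) :
    ∃ δ : ℝ, 0 < δ ∧ ∀ t : ℝ, |t| < δ → ∀ p ∈ K, 0 < φ p + t * ψ p := by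
  rcases K.eq_empty_or_nonempty with rfl | hne
  · exact ⟨1, one_pos, by simp⟩
  obtain ⟨p, hp, hmin⟩ := hK.exists_isMinOn hne hφ
  obtain ⟨C, hC⟩ := hK.exists_bound_of_continuousOn hψ
  have hC0 : 0 ≤ C := (norm_nonneg _).trans (hC p hp)
  refine ⟨φ p / (C + 1), div_pos (hpos p hp) (by linarith), fun t ht q hq => ?_⟩
  have h1 : φ p ≤ φ q := hmin hq
  have h2 : |t * ψ q| ≤ |t| * C := by
    rw [abs_mul]
    exact mul_le_mul_of_nonneg_left (hC q hq) (abs_nonneg t)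
  have h3 := (lt_div_iff₀ (by linarith)).1 ht
  have h4 := neg_abs_le (t * ψ q)
  have := hpos p hp
  nlinarith [abs_nonneg t]

variable {V : Type*} [NormedAddCommGroup V] [InnerProductSpace ℝ V] [FiniteDimensional ℝ V]
variable {G H : V → ℝ}

theorem IsSupport.exists_add_mul (hH : IsSupport H) (hG : IsHomog G) :
    ∃ δ : ℝ, 0 < δ ∧ ∀ t : ℝ, |t| < δ → IsSupport fun x => H x + t * G x := by
  have hS : ∀ x ∈ sphere (0 : V) 1, x ≠ 0 := fun x hx =>
    ne_zero_of_norm_eq_one (by simpa using hx)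
  obtain ⟨δ₁, hδ₁, h₁⟩ := (isCompact_sphere (0 : V) 1).exists_forall_pos_add_mul
    (hH.smooth.continuousOn.mono hS) (hG.smooth.continuousOn.mono hS)
    fun x hx => hH.pos x (by simpa using hx)
  have hq : ∀ {T : V → V →L[ℝ] V}, ContinuousOn T {0}ᶜ → ContinuousOn
      (fun p : V × V => ⟪T p.1 p.2, p.2⟫) (sphere (0 : V) 1 ×ˢ sphere (0 : V) 1) := by
    intro T hT
    exact (((hT.mono hS).comp continuousOn_fst fun p hp => hp.1).clm_apply continuousOn_snd).inner
      continuousOn_snd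
  obtain ⟨δ₂, hδ₂, h₂⟩ := ((isCompact_sphere (0 : V) 1).prod
    (isCompact_sphere (0 : V) 1)).exists_forall_pos_add_mul
    (hq hH.smooth.continuousOn_curvOp) (hq hG.smooth.continuousOn_hessian)
    fun p hp => hH.posDef _ _ (by simpa using hp.1)
      (ne_zero_of_norm_eq_one (by simpa using hp.2))
  refine ⟨min δ₁ δ₂, lt_min hδ₁ hδ₂, fun t ht =>
    ⟨hH.toIsHomog.add (hG.const_mul t), fun x hx => h₁ t (ht.trans_le (min_le_left _ _)) x
      (by simpa using hx), fun x v hx hv => ?_⟩⟩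
  have h3 := h₂ t (ht.trans_le (min_le_right _ _)) (x, ‖v‖⁻¹ • v)
    ⟨by simpa using hx, by simpa using norm_normalize hv⟩
  rw [curvOp_add_const_mul hH.smooth hG.smooth (ne_zero_of_norm_eq_one hx)]
  have hr := inv_pos.2 (norm_pos_iff.2 hv)
  have h4 : ⟪curvOp H x (‖v‖⁻¹ • v), ‖v‖⁻¹ • v⟫ + t * ⟪hessian G x (‖v‖⁻¹ • v), ‖v‖⁻¹ • v⟫ =
      (‖v‖⁻¹ * ‖v‖⁻¹) * ⟪(curvOp H x + t • hessian G x) v, v⟫ := by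
    simp only [map_smul, add_apply, smul_apply, inner_add_left, real_inner_smul_left,
      real_inner_smul_right]
    ring
  simp only at h3
  rw [h4] at h3
  exact pos_of_mul_pos_right h3 (by positivity)

end Perturbation

section Derivatives

open scoped ContDiff Topology

theorem nonpos_of_mul_neg_le_sq {W W₁ : ℝ → ℝ} {w : ℝ} (h1 : ∀ᶠ t in 𝓝 0, HasDerivAt W (W₁ t) t)
    (h2 : HasDerivAt W₁ w 0) (h0 : W₁ 0 = 0) (hpos : 0 < W 0)
    (hle : ∀ᶠ t in 𝓝 0, W t * W (-t) ≤ W 0 ^ 2) : w ≤ 0 := by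
  by_contra! hw
  have hneg : Filter.Tendsto (fun t : ℝ => -t) (𝓝 0) (𝓝 0) := by
    simpa using (continuous_neg (G := ℝ)).tendsto 0
  have hcomp : ∀ {f : ℝ → ℝ} {f' s : ℝ}, HasDerivAt f f' (-s) →
      HasDerivAt (fun t => f (-t)) (-f') s := by
    intro f f' s h
    have h3 := HasDerivAt.comp (h₂ := f) s h (hasDerivAt_neg s)
    rwa [mul_neg_one] at h3
  have hd : ∀ᶠ t in 𝓝 0, HasDerivAt (fun t => W t * W (-t))
      (W₁ t * W (-t) - W t * W₁ (-t)) t := by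
    filter_upwards [h1, hneg.eventually h1] with t ht ht'
    exact (ht.mul (hcomp ht')).congr_deriv (by ring)
  have hderiv : deriv (fun t => W t * W (-t)) =ᶠ[𝓝 0] fun t => W₁ t * W (-t) - W t * W₁ (-t) :=
    hd.mono fun t ht => ht.deriv
  have hW0 := h1.self_of_nhds
  have hd2 : HasDerivAt (deriv fun t => W t * W (-t)) (2 * w * W 0) 0 := by
    refine HasDerivAt.congr_of_eventuallyEq ?_ hderiv
    have e1 : HasDerivAt (fun t => W (-t)) (-W₁ 0) 0 := hcomp (by rwa [neg_zero])
    have e2 : HasDerivAt (fun t => W₁ (-t)) (-w) 0 := hcomp (by rwa [neg_zero])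
    refine ((h2.mul e1).sub (hW0.mul e2)).congr_deriv ?_
    simp only [neg_zero, h0]
    ring
  have hmin := isLocalMin_of_deriv_deriv_pos (f := fun t => W t * W (-t)) (x₀ := 0)
    (by rw [hd2.deriv]; positivity) (by rw [hderiv.self_of_nhds]; simp [h0])
    hd.self_of_nhds.continuousAt
  have hconst : (fun t => W t * W (-t)) =ᶠ[𝓝 0] fun _ => W 0 ^ 2 := by
    filter_upwards [hmin, hle] with t ht ht'
    refine le_antisymm ht' (le_trans (le_of_eq ?_) ht)
    simp only [neg_zero]
    ring
  have hz : deriv (fun t => W t * W (-t)) =ᶠ[𝓝 0] fun _ => 0 := by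
    filter_upwards [hconst.deriv] with t ht
    rw [ht, deriv_const]
  have h4 := hz.deriv_eq
  rw [hd2.deriv, deriv_const] at h4
  have : 0 < 2 * w * W 0 := by positivity
  linarith

variable {n : ℕ}

theorem hasDerivAt_integral_sphereMeas {φ φ' : ℝ → E n → ℝ}
    (hφ : ∀ t, ContinuousOn (φ t) (sphere 0 1))
    (hd : ∀ t, ∀ x ∈ sphere (0 : E n) 1, HasDerivAt (fun t => φ t x) (φ' t x) t)
    (hφ' : ContinuousOn (fun p : ℝ × E n => φ' p.1 p.2) (univ ×ˢ sphere 0 1)) (t : ℝ) :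
    HasDerivAt (fun t => ∫ x, φ t x ∂sphereMeas n) (∫ x, φ' t x ∂sphereMeas n) t := by
  obtain ⟨C, hC⟩ := ((isCompact_closedBall t 1).prod
    (isCompact_sphere (0 : E n) 1)).exists_bound_of_continuousOn
    (hφ'.mono (prod_mono (subset_univ _) subset_rfl))
  have hφ't : ContinuousOn (φ' t) (sphere 0 1) :=
    hφ'.comp (f := fun x : E n => (t, x)) (by fun_prop) fun x hx => ⟨mem_univ _, hx⟩
  exact (hasDerivAt_integral_of_dominated_loc_of_deriv_le (bound := fun _ => C)
    (ball_mem_nhds t one_pos)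
    (Filter.Eventually.of_forall fun s => (integrable_sphereMeas (hφ s)).aestronglyMeasurable)
    (integrable_sphereMeas (hφ t)) (integrable_sphereMeas hφ't).aestronglyMeasurable
    (ae_sphereMeas_mem_sphere.mono fun x hx s hs => hC (s, x) ⟨ball_subset_closedBall hs, hx⟩)
    (integrable_const C)
    (ae_sphereMeas_mem_sphere.mono fun x hx s _ => hd s x hx)).2

end Derivatives

section Families

variable {V : Type*} [NormedAddCommGroup V] [InnerProductSpace ℝ V] [FiniteDimensional ℝ V]
variable {A B C : V → V →L[ℝ] V} {a b : V → ℝ} {S : Set V}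

theorem continuousOn_add_smul_prod (hA : ContinuousOn A S) (hB : ContinuousOn B S) :
    ContinuousOn (fun p : ℝ × V => A p.2 + p.1 • B p.2) (univ ×ˢ S) := by
  have h : ∀ {A : V → V →L[ℝ] V}, ContinuousOn A S →
      ContinuousOn (fun p : ℝ × V => A p.2) (univ ×ˢ S) := fun hA =>
    hA.comp continuousOn_snd fun p hp => hp.2
  exact (h hA).add (continuousOn_fst.smul (h hB))

theorem continuousOn_add_mul_prod (ha : ContinuousOn a S) (hb : ContinuousOn b S) :
    ContinuousOn (fun p : ℝ × V => a p.2 + p.1 * b p.2) (univ ×ˢ S) := by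
  have h : ∀ {a : V → ℝ}, ContinuousOn a S →
      ContinuousOn (fun p : ℝ × V => a p.2) (univ ×ˢ S) := fun ha =>
    ha.comp continuousOn_snd fun p hp => hp.2
  exact (h ha).add (continuousOn_fst.mul (h hb))

theorem continuousOn_det_prod (hA : ContinuousOn A S) (hB : ContinuousOn B S) :
    ContinuousOn (fun p : ℝ × V => (A p.2 + p.1 • B p.2).det) (univ ×ˢ S) :=
  (contDiff_det (k := 0)).continuous.comp_continuousOn (continuousOn_add_smul_prod hA hB)

theorem ContinuousOn.dDet (hA : ContinuousOn A S) (hB : ContinuousOn B S) :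
    ContinuousOn (fun x => dDet (A x) (B x)) S :=
  continuous_dDet.comp_continuousOn (hA.prodMk hB)

theorem continuousOn_dDet_prod (hA : ContinuousOn A S) (hB : ContinuousOn B S)
    (hC : ContinuousOn C S) :
    ContinuousOn (fun p : ℝ × V => dDet (A p.2 + p.1 • B p.2) (C p.2)) (univ ×ˢ S) :=
  continuous_dDet.comp_continuousOn ((continuousOn_add_smul_prod hA hB).prodMk
    (hC.comp continuousOn_snd fun _ hp => hp.2))

theorem ContinuousOn.d2Det (hA : ContinuousOn A S) (hB : ContinuousOn B S)
    (hC : ContinuousOn C S) : ContinuousOn (fun x => d2Det (A x) (B x) (C x)) S :=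
  continuous_d2Det.comp_continuousOn (hA.prodMk (hB.prodMk hC))

theorem continuousOn_d2Det_prod (hA : ContinuousOn A S) (hB : ContinuousOn B S)
    (hC : ContinuousOn C S) :
    ContinuousOn (fun p : ℝ × V => d2Det (A p.2 + p.1 • B p.2) (C p.2) (B p.2)) (univ ×ˢ S) :=
  continuous_d2Det.comp_continuousOn ((continuousOn_add_smul_prod hA hB).prodMk
    ((hC.comp continuousOn_snd fun _ hp => hp.2).prodMk
      (hB.comp continuousOn_snd fun _ hp => hp.2)))

theorem continuousOn_slice {φ : ℝ × V → ℝ} (h : ContinuousOn φ (univ ×ˢ S)) (t : ℝ) :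
    ContinuousOn (fun x => φ (t, x)) S :=
  h.comp (f := fun x : V => (t, x)) (by fun_prop) fun _ hx => ⟨mem_univ _, hx⟩

theorem hasDerivAt_add_mul (a b t : ℝ) : HasDerivAt (fun t => a + t * b) b t := by
  simpa using ((hasDerivAt_id t).mul_const b).const_add a

theorem add_zero_smul_operator (A B : V →L[ℝ] V) : A + (0 : ℝ) • B = A := by
  rw [zero_smul, add_zero]

end Families

section Identities

open scoped ContDiff Topology

variable {n : ℕ} {G H K : E n → ℝ}

theorem IsHomog.continuousOn_sphere (hG : IsHomog G) : ContinuousOn G (sphere 0 1) :=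
  hG.smooth.continuousOn.mono sphere_subset_compl_zero

theorem IsHomog.continuousOn_hessian_sphere (hG : IsHomog G) :
    ContinuousOn (hessian G) (sphere 0 1) :=
  hG.smooth.continuousOn_hessian.mono sphere_subset_compl_zero

theorem IsHomog.continuousOn_curvOp_sphere (hG : IsHomog G) :
    ContinuousOn (curvOp G) (sphere 0 1) :=
  hG.smooth.continuousOn_curvOp.mono sphere_subset_compl_zero

theorem IsHomog.continuousOn_det_sphere (hG : IsHomog G) :
    ContinuousOn (fun x => (curvOp G x).det) (sphere 0 1) :=
  hG.smooth.continuousOn_det_curvOp.mono sphere_subset_compl_zero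

theorem integral_sphereMeas_congr {φ ψ : E n → ℝ} (h : ∀ x, ‖x‖ = 1 → φ x = ψ x) :
    ∫ x, φ x ∂sphereMeas n = ∫ x, ψ x ∂sphereMeas n :=
  integral_congr_ae (ae_sphereMeas_mem_sphere.mono fun x hx => h x (by simpa using hx))

theorem integral_sphereMeas_add {φ ψ : E n → ℝ} (hφ : ContinuousOn φ (sphere 0 1))
    (hψ : ContinuousOn ψ (sphere 0 1)) :
    ∫ x, (φ x + ψ x) ∂sphereMeas n = (∫ x, φ x ∂sphereMeas n) + ∫ x, ψ x ∂sphereMeas n :=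
  integral_add (integrable_sphereMeas hφ) (integrable_sphereMeas hψ)

theorem coneVolume_add_mul (hH : IsHomog H) (hG : IsHomog G) (t : ℝ) :
    coneVolume (fun x => H x + t * G x) =
      ∫ x, (H x + t * G x) * (curvOp H x + t • hessian G x).det ∂sphereMeas n :=
  integral_sphereMeas_congr fun x hx => by
    rw [curvOp_add_const_mul hH.smooth hG.smooth (ne_zero_of_norm_eq_one hx)]

theorem hasDerivAt_coneVolume (hH : IsHomog H) (hG : IsHomog G) (t : ℝ) :
    HasDerivAt (fun t => coneVolume fun x => H x + t * G x)
      (∫ x, (G x * (curvOp H x + t • hessian G x).det +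
        (H x + t * G x) * dDet (curvOp H x + t • hessian G x) (hessian G x)) ∂sphereMeas n) t := by
  simp only [coneVolume_add_mul hH hG]
  have hh := hH.continuousOn_sphere
  have hg := hG.continuousOn_sphere
  have hA := hH.continuousOn_curvOp_sphere
  have hB := hG.continuousOn_hessian_sphere
  exact hasDerivAt_integral_sphereMeas
    (φ := fun t x => (H x + t * G x) * (curvOp H x + t • hessian G x).det)
    (φ' := fun t x => G x * (curvOp H x + t • hessian G x).det +
        (H x + t * G x) * dDet (curvOp H x + t • hessian G x) (hessian G x))
    (fun t => continuousOn_slice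
      ((continuousOn_add_mul_prod hh hg).mul (continuousOn_det_prod hA hB)) t)
    (fun t x _ => (hasDerivAt_add_mul _ _ t).mul (hasDerivAt_det_add_smul _ _ t))
    (((hg.comp continuousOn_snd fun p hp => hp.2).mul (continuousOn_det_prod hA hB)).add
      ((continuousOn_add_mul_prod hh hg).mul (continuousOn_dDet_prod hA hB hB))) t

theorem hasDerivAt_integral_div_pow (hH : IsSupport H) (hG : IsHomog G) :
    HasDerivAt (fun t : ℝ => ∫ x, ((H x + t * G x) / H x) ^ (n + 1) *
        (H x * (curvOp H x).det) ∂sphereMeas n)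
      ((n + 1) * ∫ x, G x * (curvOp H x).det ∂sphereMeas n) 0 := by
  have hh := hH.continuousOn_sphere
  have hg := hG.continuousOn_sphere
  have hs := hH.continuousOn_det_sphere
  have hne : ∀ x ∈ sphere (0 : E n) 1, H x ≠ 0 := fun x hx => (hH.pos x (by simpa using hx)).ne'
  have hsnd : ∀ {a : E n → ℝ}, ContinuousOn a (sphere 0 1) →
      ContinuousOn (fun p : ℝ × E n => a p.2) (univ ×ˢ sphere 0 1) := fun ha =>
    ha.comp continuousOn_snd fun p hp => hp.2
  have hq : ContinuousOn (fun p : ℝ × E n => (H p.2 + p.1 * G p.2) / H p.2)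
      (univ ×ˢ sphere 0 1) :=
    (continuousOn_add_mul_prod hh hg).div (hsnd hh) fun p hp => hne _ hp.2
  have h := hasDerivAt_integral_sphereMeas
    (φ := fun t x => ((H x + t * G x) / H x) ^ (n + 1) * (H x * (curvOp H x).det))
    (φ' := fun t x => ((n + 1 : ℕ) * ((H x + t * G x) / H x) ^ n * (G x / H x)) *
      (H x * (curvOp H x).det))
    (fun t => continuousOn_slice ((hq.pow _).mul (hsnd (hh.mul hs))) t)
    (fun t x _ => (((hasDerivAt_add_mul (H x) (G x) t).div_const (H x)).pow (n + 1)).mul_const _)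
    (((continuousOn_const.mul (hq.pow _)).mul (hsnd (hg.div hh hne))).mul (hsnd (hh.mul hs))) 0
  refine h.congr_deriv ?_
  rw [← integral_const_mul]
  refine integral_sphereMeas_congr fun x hx => ?_
  have := (hH.pos x hx).ne'
  rw [zero_mul, add_zero, div_self this, one_pow]
  push_cast
  field_simp

theorem integral_mul_dDet_hessian (hH : IsSupport H) (hG : IsHomog G) :
    ∫ x, H x * dDet (curvOp H x) (hessian G x) ∂sphereMeas n =
      n * ∫ x, G x * (curvOp H x).det ∂sphereMeas n := by
  have h1 := hasDerivAt_integral_div_pow hH hG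
  have h2 := hasDerivAt_coneVolume hH.toIsHomog hG 0
  have h3 : IsLocalMin (fun t : ℝ => (∫ x, ((H x + t * G x) / H x) ^ (n + 1) *
        (H x * (curvOp H x).det) ∂sphereMeas n) - coneVolume fun x => H x + t * G x) 0 := by
    obtain ⟨δ, hδ, hsup⟩ := hH.exists_add_mul hG
    filter_upwards [ball_mem_nhds (0 : ℝ) hδ] with t ht
    have h4 := coneVolume_le hH (hsup t (by simpa using ht))
    have h5 : (∫ x, ((H x + 0 * G x) / H x) ^ (n + 1) * (H x * (curvOp H x).det) ∂sphereMeas n) =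
        coneVolume fun x => H x + 0 * G x := by
      simp only [zero_mul, add_zero]
      refine integral_sphereMeas_congr fun x hx => ?_
      rw [div_self (hH.pos x hx).ne', one_pow, one_mul]
    rw [h5, sub_self]
    exact sub_nonneg.2 h4
  have h4 := h3.hasDerivAt_eq_zero (h1.sub h2)
  simp only [add_zero_smul_operator, zero_mul, add_zero] at h4
  rw [integral_sphereMeas_add (φ := fun x => G x * (curvOp H x).det)
    (ψ := fun x => H x * dDet (curvOp H x) (hessian G x))
    (hG.continuousOn_sphere.mul hH.continuousOn_det_sphere)
    (hH.continuousOn_sphere.mul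
      (hH.continuousOn_curvOp_sphere.dDet hG.continuousOn_hessian_sphere))] at h4
  linarith

theorem integral_mul_d2Det_hessian (hH : IsSupport H) (hG : IsHomog G) (hK : IsHomog K) :
    (∫ x, K x * dDet (curvOp H x) (hessian G x) ∂sphereMeas n) +
      ∫ x, H x * d2Det (curvOp H x) (hessian G x) (hessian K x) ∂sphereMeas n =
      n * ∫ x, G x * dDet (curvOp H x) (hessian K x) ∂sphereMeas n := by
  have hh := hH.continuousOn_sphere
  have hg := hG.continuousOn_sphere
  have hk := hK.continuousOn_sphere
  have hA := hH.continuousOn_curvOp_sphere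
  have hB := hG.continuousOn_hessian_sphere
  have hC := hK.continuousOn_hessian_sphere
  have hsnd : ∀ {a : E n → ℝ}, ContinuousOn a (sphere 0 1) →
      ContinuousOn (fun p : ℝ × E n => a p.2) (univ ×ˢ sphere 0 1) := fun ha =>
    ha.comp continuousOn_snd fun p hp => hp.2
  have h1 := hasDerivAt_integral_sphereMeas
    (φ := fun t x => (H x + t * K x) * dDet (curvOp H x + t • hessian K x) (hessian G x))
    (φ' := fun t x => K x * dDet (curvOp H x + t • hessian K x) (hessian G x) +
      (H x + t * K x) * d2Det (curvOp H x + t • hessian K x) (hessian G x) (hessian K x))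
    (fun t => continuousOn_slice
      ((continuousOn_add_mul_prod hh hk).mul (continuousOn_dDet_prod hA hC hB)) t)
    (fun t x _ => (hasDerivAt_add_mul _ _ t).mul (hasDerivAt_dDet_add_smul _ _ _ t))
    (((hsnd hk).mul (continuousOn_dDet_prod hA hC hB)).add
      ((continuousOn_add_mul_prod hh hk).mul (continuousOn_d2Det_prod hA hC hB))) 0
  have h2 := (hasDerivAt_integral_sphereMeas
    (φ := fun t x => G x * (curvOp H x + t • hessian K x).det)
    (φ' := fun t x => G x * dDet (curvOp H x + t • hessian K x) (hessian K x))
    (fun t => continuousOn_slice ((hsnd hg).mul (continuousOn_det_prod hA hC)) t)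
    (fun t x _ => (hasDerivAt_det_add_smul _ _ t).const_mul _)
    ((hsnd hg).mul (continuousOn_dDet_prod hA hC hC)) 0).const_mul (n : ℝ)
  have h3 : (fun t : ℝ => ∫ x, (H x + t * K x) *
        dDet (curvOp H x + t • hessian K x) (hessian G x) ∂sphereMeas n) =ᶠ[𝓝 0]
      fun t => (n : ℝ) * ∫ x, G x * (curvOp H x + t • hessian K x).det ∂sphereMeas n := by
    obtain ⟨δ, hδ, hsup⟩ := hH.exists_add_mul hK
    filter_upwards [ball_mem_nhds (0 : ℝ) hδ] with t ht
    have h4 := integral_mul_dDet_hessian (hsup t (by simpa using ht)) hG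
    rw [integral_sphereMeas_congr (ψ := fun x => (H x + t * K x) *
        dDet (curvOp H x + t • hessian K x) (hessian G x)) fun x hx => by
      rw [curvOp_add_const_mul hH.smooth hK.smooth (ne_zero_of_norm_eq_one hx)]] at h4
    rw [h4]
    congr 1
    refine integral_sphereMeas_congr fun x hx => ?_
    rw [curvOp_add_const_mul hH.smooth hK.smooth (ne_zero_of_norm_eq_one hx)]
  have h4 := h1.unique (h2.congr_of_eventuallyEq h3)
  simp only [add_zero_smul_operator, zero_mul, add_zero] at h4
  rwa [integral_sphereMeas_add (φ := fun x => K x * dDet (curvOp H x) (hessian G x))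
    (ψ := fun x => H x * d2Det (curvOp H x) (hessian G x) (hessian K x))
    (hk.mul (hA.dDet hB)) (hh.mul (hA.d2Det hB hC))] at h4

theorem integral_mul_dDet_comm (hH : IsSupport H) (hG : IsHomog G) (hK : IsHomog K) :
    ∫ x, K x * dDet (curvOp H x) (hessian G x) ∂sphereMeas n =
      ∫ x, G x * dDet (curvOp H x) (hessian K x) ∂sphereMeas n := by
  have h1 := integral_mul_d2Det_hessian hH hG hK
  have h2 := integral_mul_d2Det_hessian hH hK hG
  simp only [d2Det_comm _ (hessian K _) (hessian G _)] at h2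
  have h3 : (n + 1 : ℝ) * ((∫ x, K x * dDet (curvOp H x) (hessian G x) ∂sphereMeas n) -
      ∫ x, G x * dDet (curvOp H x) (hessian K x) ∂sphereMeas n) = 0 := by linarith
  have h4 : (n + 1 : ℝ) ≠ 0 := by positivity
  exact sub_eq_zero.1 ((mul_eq_zero.1 h3).resolve_left h4)

theorem coneVolume_pos (hH : IsSupport H) : 0 < coneVolume H := by
  refine (coneVolume_nonneg hH).lt_of_ne' fun h0 => ?_
  obtain ⟨x, hx⟩ : (sphere (0 : E n) 1).Nonempty := NormedSpace.sphere_nonempty.2 zero_le_one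
  have h1 := eq_zero_of_integral_sphereMeas_eq_zero
    (hH.continuousOn_sphere.mul hH.continuousOn_det_sphere)
    (fun x hx => (mul_pos (hH.pos x (by simpa using hx)) (hH.det_pos (by simpa using hx))).le)
    h0 x hx
  exact (mul_pos (hH.pos x (by simpa using hx)) (hH.det_pos (by simpa using hx))).ne' h1

theorem integral_mul_dDet_self_nonpos (hH : IsSupport H) (hG : IsHomog G)
    (h0 : ∫ x, G x * (curvOp H x).det ∂sphereMeas n = 0) :
    ∫ x, G x * dDet (curvOp H x) (hessian G x) ∂sphereMeas n ≤ 0 := by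
  have hg := hG.continuousOn_sphere
  have hA := hH.continuousOn_curvOp_sphere
  have hB := hG.continuousOn_hessian_sphere
  have hsnd : ContinuousOn (fun p : ℝ × E n => G p.2) (univ ×ˢ sphere 0 1) :=
    hg.comp continuousOn_snd fun p hp => hp.2
  obtain ⟨δ, hδ, hsup⟩ := hH.exists_add_mul hG
  have h1 : ∀ᶠ t in 𝓝 0, HasDerivAt (fun t => coneVolume fun x => H x + t * G x)
      ((n + 1) * ∫ x, G x * (curvOp H x + t • hessian G x).det ∂sphereMeas n) t := by
    filter_upwards [ball_mem_nhds (0 : ℝ) hδ] with t ht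
    have hs := hsup t (by simpa using ht)
    refine (hasDerivAt_coneVolume hH.toIsHomog hG t).congr_deriv ?_
    have h4 := integral_mul_dDet_hessian hs hG
    have h5 : ∀ x : E n, ‖x‖ = 1 → curvOp (fun x => H x + t * G x) x =
        curvOp H x + t • hessian G x := fun x hx =>
      curvOp_add_const_mul hH.smooth hG.smooth (ne_zero_of_norm_eq_one hx) t
    rw [integral_sphereMeas_congr (ψ := fun x => (H x + t * G x) *
        dDet (curvOp H x + t • hessian G x) (hessian G x)) fun x hx => by rw [h5 x hx],
      integral_sphereMeas_congr (φ := fun x => G x * (curvOp (fun x => H x + t * G x) x).det)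
        (ψ := fun x => G x * (curvOp H x + t • hessian G x).det) fun x hx => by rw [h5 x hx]] at h4
    rw [integral_sphereMeas_add (φ := fun x => G x * (curvOp H x + t • hessian G x).det)
      (ψ := fun x => (H x + t * G x) * dDet (curvOp H x + t • hessian G x) (hessian G x))
      (continuousOn_slice (hsnd.mul (continuousOn_det_prod hA hB)) t) (continuousOn_slice
      ((continuousOn_add_mul_prod hH.continuousOn_sphere hg).mul
        (continuousOn_dDet_prod hA hB hB)) t), h4]
    ring
  have h2 := (hasDerivAt_integral_sphereMeas
    (φ := fun t x => G x * (curvOp H x + t • hessian G x).det)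
    (φ' := fun t x => G x * dDet (curvOp H x + t • hessian G x) (hessian G x))
    (fun t => continuousOn_slice (hsnd.mul (continuousOn_det_prod hA hB)) t)
    (fun t x _ => (hasDerivAt_det_add_smul _ _ t).const_mul _)
    (hsnd.mul (continuousOn_dDet_prod hA hB hB)) 0).const_mul (n + 1 : ℝ)
  have h3 := nonpos_of_mul_neg_le_sq h1 h2 (by simp only [add_zero_smul_operator, h0, mul_zero])
    (by simpa only [zero_mul, add_zero] using coneVolume_pos hH) (by
      filter_upwards [ball_mem_nhds (0 : ℝ) hδ] with t ht
      simp only [zero_mul, add_zero]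
      exact coneVolume_mul_le_sq hH (hsup t (by simpa using ht)) (hsup (-t) (by simpa using ht)))
  simp only [add_zero_smul_operator] at h3
  exact nonpos_of_mul_nonpos_right h3 (by positivity)

end Identities

section Pointwise

open scoped ContDiff Topology
open Module

variable {V : Type*} [NormedAddCommGroup V] [InnerProductSpace ℝ V] [FiniteDimensional ℝ V]
variable {f G H K : V → ℝ} {x : V}

theorem contDiffOn_dDet_hessian (hH : ContDiffOn ℝ ∞ H {0}ᶜ) (hG : ContDiffOn ℝ ∞ G {0}ᶜ) :
    ContDiffOn ℝ ∞ (fun x => dDet (curvOp H x) (hessian G x)) {0}ᶜ := by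
  have h1 : ContDiff ℝ ∞ fun x : V => (innerSL ℝ x).smulRight x :=
    ((ContinuousLinearMap.smulRightL ℝ V V).contDiff.comp (innerSL ℝ).contDiff).clm_apply
      contDiff_id
  have h2 : ContDiff ℝ ∞ (fderiv ℝ fun A : V →L[ℝ] V => A.det) :=
    (contDiff_det (k := ∞)).fderiv_right (by simp)
  exact (h2.comp_contDiffOn (hH.hessian_compl.add h1.contDiffOn)).clm_apply hG.hessian_compl

theorem IsSupport.dDet_hessian_self (hH : IsSupport H) (hx : ‖x‖ = 1) :
    dDet (curvOp H x) (hessian H x) = (finrank ℝ V - 1) * (curvOp H x).det :=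
  dDet_of_add_smulRight hx (hH.hessian_apply_self (ne_zero_of_norm_eq_one hx))
    (hH.det_pos hx).ne'

theorem IsSupport.dDet_hessian_sq_mul (hH : IsSupport H) (hf : ContDiffOn ℝ ∞ f {0}ᶜ)
    (hx : ‖x‖ = 1) :
    dDet (curvOp H x) (hessian (fun y => f y * (f y * H y)) x) =
      2 * f x * dDet (curvOp H x) (hessian (fun y => f y * H y) x) -
        f x ^ 2 * ((finrank ℝ V - 1) * (curvOp H x).det) +
        2 * H x * ((curvOp H x).det * ⟪(curvOp H x).inverse (gradient f x), gradient f x⟫) := by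
  rw [hessian_sq_mul_apply hf hH.smooth (ne_zero_of_norm_eq_one hx), dDet_add, dDet_add, dDet_smul,
    dDet_smul, dDet_smul, dDet_smulRight_self (hH.det_pos hx).ne', hH.dDet_hessian_self hx]
  ring

theorem isSymmetric_hessian (hf : ContDiffOn ℝ ∞ f {0}ᶜ) (hx : x ≠ 0) :
    (hessian f x).toLinearMap.IsSymmetric := fun u v => inner_hessian_comm hf hx u v

theorem IsSupport.d2Det_hessian_nonpos (hH : IsSupport H) (hG : IsHomog G) (hx : ‖x‖ = 1)
    (h0 : dDet (curvOp H x) (hessian G x) = 0) :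
    d2Det (curvOp H x) (hessian G x) (hessian G x) ≤ 0 ∧
      (d2Det (curvOp H x) (hessian G x) (hessian G x) = 0 → hessian G x = 0) :=
  d2Det_self_nonpos (isSymmetric_curvOp hH.smooth (ne_zero_of_norm_eq_one hx))
    (fun v hv => hH.posDef x v hx hv) (isSymmetric_hessian hG.smooth (ne_zero_of_norm_eq_one hx)) h0

theorem IsHomog.exists_eq_inner (hG : IsHomog G) (hV : 1 < finrank ℝ V)
    (h0 : ∀ x, ‖x‖ = 1 → hessian G x = 0) : ∃ v : V, ∀ x, x ≠ 0 → G x = ⟪x, v⟫ := by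
  have hz : ∀ x ∈ ({0}ᶜ : Set V), hessian G x = 0 := by
    intro x hx
    have hr : 0 < ‖x‖⁻¹ := inv_pos.2 (norm_pos_iff.2 hx)
    have h1 := hG.hessian_smul hx hr
    rw [h0 _ (norm_normalize hx), eq_comm, smul_eq_zero] at h1
    exact h1.resolve_left (inv_ne_zero hr.ne')
  have hconn : IsPreconnected ({0}ᶜ : Set V) :=
    (isConnected_compl_singleton_of_one_lt_rank (by
      rw [← finrank_eq_rank]; exact_mod_cast hV) 0).isPreconnected
  obtain ⟨v, hv⟩ := isOpen_compl_singleton.exists_is_const_of_fderiv_eq_zero hconn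
    (hG.smooth.gradient_compl.differentiableOn (by simp)) hz
  exact ⟨v, fun x hx => by rw [← hG.inner_gradient_self hx, hv x hx, real_inner_comm]⟩

theorem hessian_eq_zero_of_eq_inner {v : V} (h : ∀ x, x ≠ 0 → G x = ⟪x, v⟫) (hx : x ≠ 0) :
    hessian G x = 0 := by
  have h1 : ∀ z, z ≠ 0 → gradient G z = v := by
    intro z hz
    have h2 : G =ᶠ[𝓝 z] fun y => innerSL ℝ v y := by
      filter_upwards [eventually_ne_zero hz] with y hy
      rw [h y hy, innerSL_apply_apply, real_inner_comm]
    refine ext_inner_right ℝ fun w => ?_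
    rw [inner_gradient_left, h2.fderiv_eq, ContinuousLinearMap.fderiv, innerSL_apply_apply]
  have h3 : gradient G =ᶠ[𝓝 x] fun _ => v := by
    filter_upwards [eventually_ne_zero hx] with y hy
    exact h1 y hy
  rw [hessian, h3.fderiv_eq, fderiv_const_apply]

theorem dDet_zero_right (M : V →L[ℝ] V) : dDet M 0 = 0 := map_zero _

theorem curvOp_eq_one (hH : IsHomog H) (hV : finrank ℝ V = 1) (hx : ‖x‖ = 1) :
    curvOp H x = 1 := by
  ext v
  obtain ⟨c, rfl⟩ := (finrank_eq_one_iff_of_nonzero' x (ne_zero_of_norm_eq_one hx)).1 hV v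
  rw [map_smul, hH.curvOp_apply_self hx]
  rfl

end Pointwise

section Form

open scoped ContDiff Topology

variable {n : ℕ} {G H K L : E n → ℝ}

/-- The symmetric bilinear form given by the second variation of the volume. -/
def mixedForm (H G K : E n → ℝ) : ℝ := ∫ x, G x * dDet (curvOp H x) (hessian K x) ∂sphereMeas n

theorem mixedForm_comm (hH : IsSupport H) (hG : IsHomog G) (hK : IsHomog K) :
    mixedForm H G K = mixedForm H K G := integral_mul_dDet_comm hH hK hG

theorem mixedForm_add_mul_left (hH : IsSupport H) (hG : IsHomog G) (hK : IsHomog K)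
    (hL : IsHomog L) (c : ℝ) :
    mixedForm H (fun x => G x + c * K x) L = mixedForm H G L + c * mixedForm H K L := by
  have hd := hH.continuousOn_curvOp_sphere.dDet hL.continuousOn_hessian_sphere
  have h := integral_sphereMeas_add (φ := fun x => G x * dDet (curvOp H x) (hessian L x))
    (ψ := fun x => c * (K x * dDet (curvOp H x) (hessian L x)))
    (hG.continuousOn_sphere.mul hd) ((hK.continuousOn_sphere.mul hd).const_smul c)
  rw [integral_const_mul] at h
  rw [mixedForm, mixedForm, mixedForm, ← h]
  refine integral_sphereMeas_congr fun x _ => ?_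
  ring

theorem mixedForm_add_mul_self (hH : IsSupport H) (hG : IsHomog G) (hK : IsHomog K) (c : ℝ) :
    mixedForm H (fun x => G x + c * K x) (fun x => G x + c * K x) =
      mixedForm H G G + 2 * c * mixedForm H K G + c ^ 2 * mixedForm H K K := by
  have hP : IsHomog fun x => G x + c * K x := hG.add (hK.const_mul c)
  rw [mixedForm_add_mul_left hH hG hK hP, mixedForm_comm hH hG hP, mixedForm_comm hH hK hP,
    mixedForm_add_mul_left hH hG hK hG, mixedForm_add_mul_left hH hG hK hK,
    mixedForm_comm hH hG hK]
  ring

theorem mixedForm_eq_zero_of_self_eq_zero (hH : IsSupport H) (hG : IsHomog G) (hK : IsHomog K)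
    (h0 : ∫ x, G x * (curvOp H x).det ∂sphereMeas n = 0) (hG0 : mixedForm H G G = 0)
    (hK0 : ∫ x, K x * (curvOp H x).det ∂sphereMeas n = 0) : mixedForm H K G = 0 := by
  have hle : ∀ c : ℝ, 2 * c * mixedForm H K G + c ^ 2 * mixedForm H K K ≤ 0 := by
    intro c
    have h1 : ∫ x, (G x + c * K x) * (curvOp H x).det ∂sphereMeas n = 0 := by
      have h := integral_sphereMeas_add (φ := fun x => G x * (curvOp H x).det)
        (ψ := fun x => c * (K x * (curvOp H x).det))
        (hG.continuousOn_sphere.mul hH.continuousOn_det_sphere)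
        ((hK.continuousOn_sphere.mul hH.continuousOn_det_sphere).const_smul c)
      rw [integral_const_mul, h0, hK0, mul_zero, add_zero] at h
      rw [← h]
      refine integral_sphereMeas_congr fun x _ => ?_
      ring
    have h2 := integral_mul_dDet_self_nonpos hH (hG.add (hK.const_mul c)) h1
    have h3 := mixedForm_add_mul_self hH hG hK c
    rw [mixedForm] at h3
    rw [h3, hG0, zero_add] at h2
    exact h2
  set a := mixedForm H K G
  set b := mixedForm H K K
  by_contra ha
  have hb : 0 < |b| + 1 := by positivity
  have h1 := hle (a / (|b| + 1))
  have h2 : 2 * (a / (|b| + 1)) * a + (a / (|b| + 1)) ^ 2 * b =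
      a ^ 2 * (2 * (|b| + 1) + b) / (|b| + 1) ^ 2 := by
    field_simp
  rw [h2] at h1
  have h3 : 0 < 2 * (|b| + 1) + b := by linarith [neg_abs_le b]
  have : 0 < a ^ 2 * (2 * (|b| + 1) + b) / (|b| + 1) ^ 2 := by positivity
  linarith

theorem dDet_hessian_eq_zero (hH : IsSupport H) (hG : IsHomog G)
    (h0 : ∫ x, G x * (curvOp H x).det ∂sphereMeas n = 0) (hG0 : mixedForm H G G = 0) :
    ∀ x, ‖x‖ = 1 → dDet (curvOp H x) (hessian G x) = 0 := by
  have hψ := contDiffOn_dDet_hessian hH.smooth hG.smooth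
  set ψ := fun x => dDet (curvOp H x) (hessian G x) with hψdef
  have hK : IsHomog fun x => ψ (‖x‖⁻¹ • x) * ‖x‖ := isHomog_norm.comp_normalize_mul hψ
  set K := fun x => ψ (‖x‖⁻¹ • x) * ‖x‖ with hKdef
  set c := (∫ x, K x * (curvOp H x).det ∂sphereMeas n) / coneVolume H with hc
  have hm : ∫ x, (K x + (-c) * H x) * (curvOp H x).det ∂sphereMeas n = 0 := by
    have h := integral_sphereMeas_add (φ := fun x => K x * (curvOp H x).det)
      (ψ := fun x => (-c) * (H x * (curvOp H x).det))
      (hK.continuousOn_sphere.mul hH.continuousOn_det_sphere)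
      ((hH.continuousOn_sphere.mul hH.continuousOn_det_sphere).const_smul (-c))
    rw [integral_const_mul] at h
    have h1 : (∫ x, K x * (curvOp H x).det ∂sphereMeas n) + -c * coneVolume H = 0 := by
      rw [hc, neg_mul, div_mul_cancel₀ _ (coneVolume_pos hH).ne', add_neg_cancel]
    refine Eq.trans ?_ (h.trans h1)
    refine integral_sphereMeas_congr fun x _ => ?_
    ring
  have h1 := mixedForm_eq_zero_of_self_eq_zero hH hG (hK.add (hH.toIsHomog.const_mul (-c)))
    h0 hG0 hm
  rw [mixedForm_add_mul_left hH hK hH.toIsHomog hG] at h1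
  have h2 : mixedForm H H G = 0 := by
    rw [mixedForm, integral_mul_dDet_hessian hH hG, h0, mul_zero]
  rw [h2, mul_zero, add_zero] at h1
  have h3 : ∫ x, ψ x ^ 2 ∂sphereMeas n = 0 := by
    rw [← h1]
    refine integral_sphereMeas_congr fun x hx => ?_
    simp only [hKdef, hψdef, hx, inv_one, one_smul, mul_one, sq]
  intro x hx
  have h4 := eq_zero_of_integral_sphereMeas_eq_zero
    ((hψ.continuousOn.mono sphere_subset_compl_zero).pow 2) (fun x _ => sq_nonneg (ψ x)) h3 x
    (by simpa using hx)
  exact pow_eq_zero_iff two_ne_zero |>.1 h4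

theorem hessian_eq_zero_of_mixedForm_self_eq_zero (hH : IsSupport H) (hG : IsHomog G)
    (h0 : ∫ x, G x * (curvOp H x).det ∂sphereMeas n = 0) (hG0 : mixedForm H G G = 0) :
    ∀ x, ‖x‖ = 1 → hessian G x = 0 := by
  have hd := dDet_hessian_eq_zero hH hG h0 hG0
  have h1 := integral_mul_d2Det_hessian hH hG hG
  have h2 : ∫ x, G x * dDet (curvOp H x) (hessian G x) ∂sphereMeas n = 0 := hG0
  rw [h2, zero_add, mul_zero] at h1
  have h3 : ∫ x, -(H x * d2Det (curvOp H x) (hessian G x) (hessian G x)) ∂sphereMeas n = 0 := by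
    rw [integral_neg, h1, neg_zero]
  intro x hx
  have hnp : ∀ x ∈ sphere (0 : E n) 1,
      0 ≤ -(H x * d2Det (curvOp H x) (hessian G x) (hessian G x)) := by
    intro x hx
    have hx' : ‖x‖ = 1 := by simpa using hx
    have h4 := (hH.d2Det_hessian_nonpos hG hx' (hd x hx')).1
    have := mul_nonpos_of_nonneg_of_nonpos (hH.pos x hx').le h4
    linarith
  have h5 := eq_zero_of_integral_sphereMeas_eq_zero
    (φ := fun x => -(H x * d2Det (curvOp H x) (hessian G x) (hessian G x)))
    (hH.continuousOn_sphere.mul (hH.continuousOn_curvOp_sphere.d2Det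
      hG.continuousOn_hessian_sphere hG.continuousOn_hessian_sphere)).neg hnp h3 x
    (by simpa using hx)
  have h6 := (mul_eq_zero.1 (neg_eq_zero.1 h5)).resolve_left (hH.pos x hx).ne'
  exact (hH.d2Det_hessian_nonpos hG hx (hd x hx)).2 h6

theorem exists_eq_inner_of_dim_one {H G : E 0 → ℝ} (hH : IsSupport H) (hG : IsHomog G)
    (h0 : ∫ x, G x * (curvOp H x).det ∂sphereMeas 0 = 0) :
    ∃ v : E 0, ∀ x, ‖x‖ = 1 → G x = ⟪x, v⟫ := by
  have hfr : Module.finrank ℝ (E 0) = 1 := by simp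
  have h1 : ∫ x, G x ∂sphereMeas 0 = 0 := by
    rw [← h0]
    refine integral_sphereMeas_congr fun x hx => ?_
    rw [curvOp_eq_one hH.toIsHomog hfr hx, ContinuousLinearMap.det]
    simp
  obtain ⟨e, he⟩ : (sphere (0 : E 0) 1).Nonempty := NormedSpace.sphere_nonempty.2 zero_le_one
  have he1 : ‖e‖ = 1 := by simpa using he
  have hcases : ∀ x : E 0, ‖x‖ = 1 → x = e ∨ x = -e := by
    intro x hx
    obtain ⟨c, rfl⟩ := (finrank_eq_one_iff_of_nonzero' e (ne_zero_of_norm_eq_one he1)).1 hfr x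
    rw [norm_smul, he1, mul_one, Real.norm_eq_abs] at hx
    rcases (abs_eq zero_le_one).1 hx with h | h
    · left; rw [h, one_smul]
    · right; rw [h, neg_one_smul]
  have hneg : ∫ x, G (-x) ∂sphereMeas 0 = ∫ x, G x ∂sphereMeas 0 := by
    have h2 := (LinearIsometryEquiv.neg ℝ (E := E 0)).toHomeomorph.measurableEmbedding.integral_map
      (μ := sphereMeas 0) G
    have h3 := sphereMeas_map (LinearIsometryEquiv.neg ℝ (E := E 0))
    rw [LinearIsometryEquiv.coe_toHomeomorph, h3] at h2
    exact h2.symm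
  have hc : ContinuousOn (fun x => G (-x)) (sphere (0 : E 0) 1) :=
    hG.continuousOn_sphere.comp continuousOn_neg fun x hx => by simpa using hx
  have h2 : ∫ x, (G x + G (-x)) ∂sphereMeas 0 = 0 := by
    rw [integral_sphereMeas_add hG.continuousOn_sphere hc, hneg, h1, add_zero]
  have h3 : ∫ _, (G e + G (-e)) ∂sphereMeas 0 = 0 := by
    rw [← h2]
    refine integral_sphereMeas_congr fun x hx => ?_
    rcases hcases x hx with rfl | rfl
    · rfl
    · rw [neg_neg, add_comm]
  rw [integral_const, smul_eq_mul, mul_eq_zero] at h3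
  have h4 : G e + G (-e) = 0 := h3.resolve_left (by
    rw [← ne_eq, measureReal_ne_zero_iff, Measure.measure_univ_ne_zero]
    exact sphereMeas_ne_zero)
  refine ⟨G e • e, fun x hx => ?_⟩
  rcases hcases x hx with rfl | rfl
  · rw [real_inner_smul_right, real_inner_self_eq_norm_sq, hx]; ring
  · rw [inner_neg_left, real_inner_smul_right, real_inner_self_eq_norm_sq, he1]; linarith

theorem integral_carre_du_champ (hH : IsSupport H) {F : E n → ℝ} (hF : ContDiffOn ℝ ∞ F {0}ᶜ) :
    ∫ x, H x ^ 2 * ((curvOp H x).det * ⟪(curvOp H x).inverse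
        (gradient F x - ⟪gradient F x, x⟫ • x), gradient F x - ⟪gradient F x, x⟫ • x⟫)
        ∂sphereMeas n =
      n * (∫ x, F x ^ 2 * (H x * (curvOp H x).det) ∂sphereMeas n) -
        mixedForm H (fun x => F (‖x‖⁻¹ • x) * H x) fun x => F (‖x‖⁻¹ • x) * H x := by
  have hF' := hF.comp_normalize
  have hG := hH.toIsHomog.comp_normalize_mul hF
  have hP := hG.comp_normalize_mul hF
  set f := fun x : E n => F (‖x‖⁻¹ • x) with hf
  set G := fun x => f x * H x with hGdef
  set P := fun x => f x * G x with hPdef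
  have hfx : ∀ x : E n, ‖x‖ = 1 → f x = F x := fun x hx => by
    rw [hf]; simp only [hx, inv_one, one_smul]
  have h1 := integral_mul_dDet_hessian hH hP
  have hA := hH.continuousOn_curvOp_sphere
  have hfc : ContinuousOn f (sphere 0 1) := hF'.continuousOn.mono sphere_subset_compl_zero
  have h2 := integral_sphereMeas_add
    (φ := fun x => 2⁻¹ * (H x * dDet (curvOp H x) (hessian P x)))
    (ψ := fun x => (-1) * (G x * dDet (curvOp H x) (hessian G x)))
    ((hH.continuousOn_sphere.mul (hA.dDet hP.continuousOn_hessian_sphere)).const_smul (2⁻¹ : ℝ))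
    ((hG.continuousOn_sphere.mul (hA.dDet hG.continuousOn_hessian_sphere)).const_smul (-1 : ℝ))
  have hc1 : ContinuousOn (fun x => P x * (curvOp H x).det) (sphere 0 1) :=
    hP.continuousOn_sphere.mul hH.continuousOn_det_sphere
  have h3 := integral_sphereMeas_add
    (φ := fun x => 2⁻¹ * (H x * dDet (curvOp H x) (hessian P x)) +
      (-1) * (G x * dDet (curvOp H x) (hessian G x)))
    (ψ := fun x => (n / 2 : ℝ) * (P x * (curvOp H x).det))
    (((hH.continuousOn_sphere.mul
      (hA.dDet hP.continuousOn_hessian_sphere)).const_smul (2⁻¹ : ℝ)).add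
    ((hG.continuousOn_sphere.mul (hA.dDet hG.continuousOn_hessian_sphere)).const_smul (-1 : ℝ)))
    (hc1.const_smul (n / 2 : ℝ))
  rw [h2, integral_const_mul, integral_const_mul, integral_const_mul, h1] at h3
  have h4 : ∫ x, F x ^ 2 * (H x * (curvOp H x).det) ∂sphereMeas n =
      ∫ x, P x * (curvOp H x).det ∂sphereMeas n := by
    refine integral_sphereMeas_congr fun x hx => ?_
    simp only [hPdef, hGdef, hfx x hx]
    ring
  rw [h4, mixedForm]
  refine Eq.trans ?_ (h3.trans (by ring))
  refine integral_sphereMeas_congr fun x hx => ?_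
  have h5 := hH.dDet_hessian_sq_mul hF' hx
  rw [finrank_euclideanSpace, Fintype.card_fin, gradient_comp_normalize hF hx] at h5
  have h6 : dDet (curvOp H x) (hessian P x) = _ := h5
  rw [h6]
  simp only [hPdef, hGdef]
  push_cast
  ring

end Form

section Main

open scoped ContDiff
open Module

variable {n : ℕ} {H F : E n → ℝ}

theorem IsSupport.mixedForm_comp_normalize_mul_self_nonpos (hH : IsSupport H)
    (hF : ContDiffOn ℝ ∞ F {0}ᶜ)
    (h0 : ∫ x, F x * (H x * (curvOp H x).det) ∂sphereMeas n = 0) :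
    mixedForm H (fun x => F (‖x‖⁻¹ • x) * H x) (fun x => F (‖x‖⁻¹ • x) * H x) ≤ 0 := by
  refine integral_mul_dDet_self_nonpos hH (hH.toIsHomog.comp_normalize_mul hF) ?_
  rw [← h0]
  refine integral_sphereMeas_congr fun x hx => ?_
  simp only [hx, inv_one, one_smul, mul_assoc]

theorem IsSupport.mixedForm_comp_normalize_mul_self_eq_zero_iff (hH : IsSupport H)
    (hF : ContDiffOn ℝ ∞ F {0}ᶜ)
    (h0 : ∫ x, F x * (H x * (curvOp H x).det) ∂sphereMeas n = 0) :
    mixedForm H (fun x => F (‖x‖⁻¹ • x) * H x) (fun x => F (‖x‖⁻¹ • x) * H x) = 0 ↔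
      ∃ v : E n, ∀ x, ‖x‖ = 1 → F x = ⟪x, v⟫ / H x := by
  have hG := hH.toIsHomog.comp_normalize_mul hF
  have hG0 : ∫ x, F (‖x‖⁻¹ • x) * H x * (curvOp H x).det ∂sphereMeas n = 0 := by
    rw [← h0]
    refine integral_sphereMeas_congr fun x hx => ?_
    simp only [hx, inv_one, one_smul, mul_assoc]
  constructor
  · intro h
    obtain ⟨v, hv⟩ : ∃ v : E n, ∀ x, ‖x‖ = 1 → F (‖x‖⁻¹ • x) * H x = ⟪x, v⟫ := by
      rcases n with _ | n
      · exact exists_eq_inner_of_dim_one hH hG hG0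
      · obtain ⟨v, hv⟩ := hG.exists_eq_inner (by simp)
          (hessian_eq_zero_of_mixedForm_self_eq_zero hH hG hG0 h)
        exact ⟨v, fun x hx => hv x (ne_zero_of_norm_eq_one hx)⟩
    refine ⟨v, fun x hx => ?_⟩
    have h1 := hv x hx
    rw [hx, inv_one, one_smul] at h1
    rw [eq_div_iff (hH.pos x hx).ne', h1]
  · rintro ⟨v, hv⟩
    have h1 : ∀ x : E n, x ≠ 0 → F (‖x‖⁻¹ • x) * H x = ⟪x, v⟫ := by
      intro x hx
      have hx' := norm_pos_iff.2 hx
      have h2 : ‖‖x‖⁻¹ • x‖ = 1 := by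
        rw [norm_smul, norm_inv, norm_norm, inv_mul_cancel₀ hx'.ne']
      have h3 := hH.pos _ h2
      have h4 := (eq_div_iff h3.ne').1 (hv _ h2)
      rw [hH.toIsHomog.map_smul _ _ (inv_pos.2 hx'), real_inner_smul_left, mul_left_comm] at h4
      exact mul_left_cancel₀ (inv_pos.2 hx').ne' h4
    have h2 : mixedForm H (fun x => F (‖x‖⁻¹ • x) * H x) (fun x => F (‖x‖⁻¹ • x) * H x) =
        ∫ _, (0 : ℝ) ∂sphereMeas n := by
      refine integral_sphereMeas_congr fun x hx => ?_
      rw [hessian_eq_zero_of_eq_inner h1 (ne_zero_of_norm_eq_one hx), dDet_zero_right, mul_zero]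
    rw [h2, integral_zero]

end Main

end Auxiliary

/-- Spectral (local) form of the Brunn–Minkowski inequality: if `∫ f h σ_n dμ = 0`
then `n ∫ f² h σ_n dμ ≤ ∫ h² σ_n^{ij} ∂_i f ∂_j f dμ`, with equality iff
`f(x) = ⟨x/h(x), v⟩`. Here `σ_n^{ij} ∂_i f ∂_j f = σ_n ⟨(A[h])⁻¹ ∇̄f, ∇̄f⟩`. -/
theorem stmt10 (n : ℕ) (H : E n → ℝ)
    (hhom : ∀ (t : ℝ) (x : E n), 0 < t → H (t • x) = t * H x)
    (hsmooth : ContDiffOn ℝ (⊤ : ℕ∞) H {(0 : E n)}ᶜ)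
    (hpos : ∀ x ∈ sphere (0 : E n) 1, 0 < H x)
    (hconvex : ∀ x ∈ sphere (0 : E n) 1, ∀ v : E n, ⟪v, x⟫ = 0 → v ≠ 0 →
      0 < ⟪(hess H x) v, v⟫)
    (F : E n → ℝ) (hF : ContDiff ℝ (⊤ : ℕ∞) F)
    (hmean : ∫ x in sphere (0 : E n) 1, F x * (H x * sigmaDet H x) ∂μH[(n : ℝ)] = 0) :
    (n : ℝ) * ∫ x in sphere (0 : E n) 1, (F x) ^ 2 * (H x * sigmaDet H x) ∂μH[(n : ℝ)] ≤
      (∫ x in sphere (0 : E n) 1,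
        (H x) ^ 2 * (sigmaDet H x *
          ⟪(hess H x + proj x).inverse (tgrad F x), tgrad F x⟫) ∂μH[(n : ℝ)]) ∧
    (((n : ℝ) * ∫ x in sphere (0 : E n) 1, (F x) ^ 2 * (H x * sigmaDet H x) ∂μH[(n : ℝ)] =
        ∫ x in sphere (0 : E n) 1,
          (H x) ^ 2 * (sigmaDet H x *
            ⟪(hess H x + proj x).inverse (tgrad F x), tgrad F x⟫) ∂μH[(n : ℝ)]) ↔
      ∃ v : E n, ∀ x ∈ sphere (0 : E n) 1, F x = ⟪x, v⟫ / H x) := by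
  have hH : IsSupport H := isSupport_of_pos_of_inner_pos ⟨hhom, hsmooth⟩
    (fun x hx => hpos x (mem_sphere_zero_iff_norm.2 hx))
    fun x v hx => hconvex x (mem_sphere_zero_iff_norm.2 hx) v
  have hF' : ContDiffOn ℝ (⊤ : ℕ∞) F {(0 : E n)}ᶜ := hF.contDiffOn
  obtain ⟨c, hc, hint⟩ := exists_setIntegral_hausdorffMeasure_sphere_eq n
  rw [hint] at hmean ⊢
  rw [hint]
  have h0 : ∫ x, F x * (H x * (curvOp H x).det) ∂sphereMeas n = 0 :=
    (mul_eq_zero.1 hmean).resolve_left hc.ne'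
  have hid : ∫ x, (H x) ^ 2 * (sigmaDet H x *
      ⟪(hess H x + proj x).inverse (tgrad F x), tgrad F x⟫) ∂sphereMeas n =
      n * (∫ x, (F x) ^ 2 * (H x * sigmaDet H x) ∂sphereMeas n) - _ :=
    integral_carre_du_champ hH hF'
  have hle := hH.mixedForm_comp_normalize_mul_self_nonpos hF' h0
  have hiff := hH.mixedForm_comp_normalize_mul_self_eq_zero_iff hF' h0
  simp only [mem_sphere_zero_iff_norm]
  rw [hid, ← hiff, mul_left_comm]
  refine ⟨mul_le_mul_of_nonneg_left (by linarith) hc.le, ?_⟩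
  rw [mul_right_inj' hc.ne']
  constructor <;> intro h <;> linarith

end
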